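/- Let α be irrational, and let f : ℝ → ℝ be a 1-periodic measurable function of semi-bounded variation satisfying ∫₀¹ log(1+|f(x)|) dx < ∞. Then for Lebesgue-almost every x ∈ [0,1), no real number E with 0 < L(E) < β(α) is an eigenvalue of the operator H(x); that is, there is no nonzero ℓ²(ℤ) solution ψ of ψ(n+1) + ψ(n−1) + f(x+nα)ψ(n) = Eψ(n). -/

import Mathlib

open MeasureTheory Filter
open scoped ENNReal NNReal

noncomputable section

attribute [local instance] Matrix.linftyOpNormedRing

/-- The truncation `[f]_B` of a real-valued function: `[f]_B x = f x` if `|f x| ≤ B`,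
and `B` otherwise. -/
def trunc (f : ℝ → ℝ) (B : ℝ) : ℝ → ℝ := fun x => if |f x| ≤ B then f x else B

/-- The total variation of a `1`-periodic function over the period `[0,1]`. -/
def pVar (f : ℝ → ℝ) : ℝ≥0∞ := eVariationOn f (Set.Icc 0 1)

/-- The semi-bounded variation `𝒱(f) = sup_{B ≥ 1} (1/B) Var [f]_B`. -/
def sVar (f : ℝ → ℝ) : ℝ≥0∞ :=
  ⨆ B : {B : ℝ // 1 ≤ B}, (ENNReal.ofReal B.1)⁻¹ * pVar (trunc f B.1)

/-- Iterates of the Gauss map, starting from the fractional part of `α`. -/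
def gaussIter (α : ℝ) : ℕ → ℝ
  | 0 => Int.fract α
  | (k+1) => Int.fract (gaussIter α k)⁻¹

/-- The continued fraction digit `a_{k+1}` of `α`. -/
def cfA (α : ℝ) (k : ℕ) : ℕ := ⌊(gaussIter α k)⁻¹⌋₊

/-- The denominators `q_k` of the continued fraction approximants of `α`:
`q₀ = 1`, `q₁ = a₁`, `q_{k+1} = a_{k+1} q_k + q_{k-1}`. -/
def cfDen (α : ℝ) : ℕ → ℕ
  | 0 => 1
  | 1 => cfA α 0
  | (k+2) => cfA α (k+1) * cfDen α (k+1) + cfDen α k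

/-- The exponential rate of approximation `β(α) = limsup_k (log q_{k+1})/q_k ∈ [0,∞]`. -/
def cfBeta (α : ℝ) : EReal :=
  Filter.limsup (fun k : ℕ => ((Real.log (cfDen α (k+1)) / (cfDen α k) : ℝ) : EReal))
    Filter.atTop

/-- The `n`-step transfer matrix `S_n^{f,E}(x) = S^{f,E}(x+(n-1)α) ⋯ S^{f,E}(x)` of the
quasiperiodic Schrödinger cocycle, where `S^{f,E}(y) = [[E - f y, -1], [1, 0]]`. -/
def schCocycle (α : ℝ) (f : ℝ → ℝ) (E : ℝ) (n : ℕ) (x : ℝ) :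
    Matrix (Fin 2) (Fin 2) ℂ :=
  ((List.range n).map fun k =>
    !![((E : ℂ) - (f (x + ((n - 1 - k : ℕ) : ℝ) * α) : ℂ)), -1; 1, 0]).prod

abbrev M2 := Matrix (Fin 2) (Fin 2) ℂ

/-- one-step matrix -/
def stepM (v : ℝ) : M2 := !![(v : ℂ), -1; 1, 0]

/-- product of the steps `a, …, a+m-1` -/
def tm (v : ℕ → ℝ) (a : ℕ) : ℕ → M2
  | 0 => 1
  | (m+1) => stepM (v (a + m)) * tm v a m

lemma norm_M2 (A : M2) : ‖A‖ = max (‖A 0 0‖ + ‖A 0 1‖) (‖A 1 0‖ + ‖A 1 1‖) := by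
  apply le_antisymm
  · rw [Matrix.linfty_opNorm_def]
    rw [← NNReal.coe_mk (max (‖A 0 0‖ + ‖A 0 1‖) (‖A 1 0‖ + ‖A 1 1‖)) (by positivity), NNReal.coe_le_coe]
    apply Finset.sup_le
    intro i _
    rw [← NNReal.coe_le_coe]
    fin_cases i <;> simp [Fin.sum_univ_two]
  · rw [Matrix.linfty_opNorm_def]
    apply max_le
    · have := Finset.le_sup (f := fun i : Fin 2 => ∑ j : Fin 2, ‖A i j‖₊) (Finset.mem_univ 0)
      rw [← NNReal.coe_le_coe] at this
      simpa [Fin.sum_univ_two] using this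
    · have := Finset.le_sup (f := fun i : Fin 2 => ∑ j : Fin 2, ‖A i j‖₊) (Finset.mem_univ 1)
      rw [← NNReal.coe_le_coe] at this
      simpa [Fin.sum_univ_two] using this

lemma norm_stepM (v : ℝ) : ‖stepM v‖ = |v| + 1 := by
  rw [norm_M2]
  simp [stepM]

lemma norm_stepM_sub (v w : ℝ) : ‖stepM v - stepM w‖ = |v - w| := by
  rw [norm_M2]
  simp only [stepM, Matrix.sub_apply]
  simp
  rw [← Complex.ofReal_sub, Complex.norm_real, Real.norm_eq_abs]

lemma det_tm (v : ℕ → ℝ) (a m : ℕ) : (tm v a m).det = 1 := by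
  induction m with
  | zero => simp [tm]
  | succ m ih => rw [tm, Matrix.det_mul, ih]; simp [stepM, Matrix.det_fin_two]

lemma one_le_norm_of_det (A : M2) (h : A.det = 1) : 1 ≤ ‖A‖ := by
  have h0 := norm_M2 A
  rw [Matrix.det_fin_two] at h
  have h1 : ‖A 0 0‖ + ‖A 0 1‖ ≤ ‖A‖ := h0 ▸ le_max_left _ _
  have h2 : ‖A 1 0‖ + ‖A 1 1‖ ≤ ‖A‖ := h0 ▸ le_max_right _ _
  have h3 : (1:ℝ) ≤ ‖A 0 0‖ * ‖A 1 1‖ + ‖A 0 1‖ * ‖A 1 0‖ := by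
    calc (1:ℝ) = ‖A 0 0 * A 1 1 - A 0 1 * A 1 0‖ := by rw [h]; simp
      _ ≤ _ := by
        refine (norm_sub_le _ _).trans ?_
        rw [norm_mul, norm_mul]
  by_contra hc
  push Not at hc
  nlinarith [norm_nonneg (A 0 0), norm_nonneg (A 0 1), norm_nonneg (A 1 0), norm_nonneg (A 1 1)]

lemma one_le_norm_tm (v : ℕ → ℝ) (a m : ℕ) : 1 ≤ ‖tm v a m‖ :=
  one_le_norm_of_det _ (det_tm v a m)

lemma norm_adj_le (A : M2) : ‖A.adjugate‖ ≤ 2 * ‖A‖ := by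
  have h0 := norm_M2 A
  have h1 : ‖A 0 0‖ + ‖A 0 1‖ ≤ ‖A‖ := h0 ▸ le_max_left _ _
  have h2 : ‖A 1 0‖ + ‖A 1 1‖ ≤ ‖A‖ := h0 ▸ le_max_right _ _
  rw [norm_M2 A.adjugate, Matrix.adjugate_fin_two]
  apply max_le <;> simp <;>
  linarith [norm_nonneg (A 0 0), norm_nonneg (A 0 1), norm_nonneg (A 1 0), norm_nonneg (A 1 1)]

lemma tm_add (v : ℕ → ℝ) (a m l : ℕ) : tm v a (m + l) = tm v (a + m) l * tm v a m := by
  induction l with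
  | zero => simp [tm]
  | succ l ih => rw [← add_assoc, tm, ih, tm, Matrix.mul_assoc, add_assoc]

lemma tm_congr (v w : ℕ → ℝ) (a b m : ℕ) (h : ∀ i, v (a + i) = w (b + i)) :
    tm v a m = tm w b m := by
  induction m with
  | zero => rfl
  | succ m ih => rw [tm, tm, ih, h]

lemma tm_sub (v w : ℕ → ℝ) (a m : ℕ) : tm w a m - tm v a m =
    ∑ j ∈ Finset.range m, tm w (a + j + 1) (m - 1 - j) *
      (stepM (w (a + j)) - stepM (v (a + j))) * tm v a j := by
  induction m with
  | zero => simp [tm]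
  | succ m ih =>
    rw [Finset.sum_range_succ]
    have : ∀ j ∈ Finset.range m, tm w (a + j + 1) (m + 1 - 1 - j) *
      (stepM (w (a + j)) - stepM (v (a + j))) * tm v a j = stepM (w (a + m)) * (tm w (a + j + 1) (m - 1 - j) *
      (stepM (w (a + j)) - stepM (v (a + j))) * tm v a j) := by
      intro j hj
      rw [Finset.mem_range] at hj
      have e1 : m + 1 - 1 - j = (m - 1 - j) + 1 := by omega
      rw [e1, tm]
      have e2 : a + j + 1 + (m - 1 - j) = a + m := by omega
      rw [e2]
      simp only [Matrix.mul_assoc]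
    rw [Finset.sum_congr rfl this, ← Finset.mul_sum, ← ih]
    have e3 : m + 1 - 1 - m = 0 := by omega
    rw [e3, tm, tm, tm]
    noncomm_ring

lemma norm_tm_sub_le (v w : ℕ → ℝ) (a m : ℕ) (K : ℝ)
    (hK : ∀ j < m, ‖tm w (a + j + 1) (m - 1 - j)‖ * ‖tm v a j‖ ≤ K) :
    ‖tm w a m - tm v a m‖ ≤ K * ∑ j ∈ Finset.range m, |w (a + j) - v (a + j)| := by
  rw [tm_sub, Finset.mul_sum]
  refine (norm_sum_le _ _).trans (Finset.sum_le_sum ?_)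
  intro j hj
  rw [Finset.mem_range] at hj
  refine (norm_mul_le _ _).trans ?_
  refine (mul_le_mul_of_nonneg_right (norm_mul_le _ _) (norm_nonneg _)).trans ?_
  rw [norm_stepM_sub]
  calc _ = (‖tm w (a + j + 1) (m - 1 - j)‖ * ‖tm v a j‖) * |w (a + j) - v (a + j)| := by ring
    _ ≤ _ := mul_le_mul_of_nonneg_right (hK j hj) (abs_nonneg _)

lemma norm_tm_le (v : ℕ → ℝ) (c : ℕ → ℝ) (a m : ℕ) (hc : ∀ i, |v i| + 1 ≤ c i) :
    ‖tm v a m‖ ≤ ∏ j ∈ Finset.range m, c (a + j) := by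
  induction m with
  | zero => simp [tm]
  | succ m ih =>
    rw [Finset.prod_range_succ, mul_comm, tm]
    refine (norm_mul_le _ _).trans ?_
    rw [norm_stepM]
    exact mul_le_mul (hc _) ih (norm_nonneg _) (by linarith [hc (a+m), abs_nonneg (v (a+m))])

lemma norm_tm_sub_le' (v w : ℕ → ℝ) (c : ℕ → ℝ) (a m : ℕ) (d : ℝ)
    (hv : ∀ i, |v i| + 1 ≤ c i) (hw : ∀ i, |w i| + 1 ≤ c i) (hd : ∀ i, |w i - v i| ≤ d) :
    ‖tm w a m - tm v a m‖ ≤ d * (m * ∏ j ∈ Finset.range m, c (a + j)) := by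
  have hc : ∀ i, 1 ≤ c i := fun i => by linarith [hv i, abs_nonneg (v i)]
  have hd0 : 0 ≤ d := (abs_nonneg _).trans (hd 0)
  induction m with
  | zero => simp [tm]
  | succ m ih =>
    rw [Finset.prod_range_succ, tm, tm]
    have hp : 0 ≤ ∏ j ∈ Finset.range m, c (a + j) :=
      Finset.prod_nonneg fun j _ => by linarith [hc (a + j)]
    have e : stepM (w (a + m)) * tm w a m - stepM (v (a + m)) * tm v a m =
      stepM (w (a + m)) * (tm w a m - tm v a m) +
        (stepM (w (a + m)) - stepM (v (a + m))) * tm v a m := by noncomm_ring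
    rw [e]
    have h1 : ‖stepM (w (a + m)) * (tm w a m - tm v a m)‖ ≤
        c (a + m) * (d * (m * ∏ j ∈ Finset.range m, c (a + j))) := by
      refine (norm_mul_le _ _).trans ?_
      rw [norm_stepM]
      exact mul_le_mul (hw _) ih (norm_nonneg _) (by linarith [hc (a+m)])
    have h2 : ‖(stepM (w (a + m)) - stepM (v (a + m))) * tm v a m‖ ≤
        d * ∏ j ∈ Finset.range m, c (a + j) := by
      refine (norm_mul_le _ _).trans ?_
      rw [norm_stepM_sub]
      exact mul_le_mul (hd _) (norm_tm_le v c a m hv) (norm_nonneg _) hd0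
    refine (norm_add_le _ _).trans ((add_le_add h1 h2).trans ?_)
    have : d * ∏ j ∈ Finset.range m, c (a + j) ≤
        d * ((∏ j ∈ Finset.range m, c (a + j)) * c (a + m)) := by
      apply mul_le_mul_of_nonneg_left _ hd0
      nlinarith [hc (a + m)]
    push_cast
    nlinarith

lemma schCocycle_succ (α : ℝ) (f : ℝ → ℝ) (E : ℝ) (n : ℕ) (x : ℝ) :
    schCocycle α f E (n + 1) x = stepM (E - f (x + n * α)) * schCocycle α f E n x := by
  rw [schCocycle, List.range_succ_eq_map, List.map_cons, List.prod_cons, List.map_map, schCocycle]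
  congr 1
  · simp [stepM]
  · congr 1
    apply List.map_congr_left
    intro k hk
    simp only [Function.comp]
    have : n + 1 - 1 - k.succ = n - 1 - k := by omega
    rw [this]

lemma schCocycle_eq_tm (α : ℝ) (f : ℝ → ℝ) (E : ℝ) (n a : ℕ) (y : ℝ) :
    schCocycle α f E n (y + a * α) = tm (fun i => E - f (y + i * α)) a n := by
  induction n with
  | zero => simp [schCocycle, tm]
  | succ n ih =>
    rw [schCocycle_succ, ih, tm]
    congr 3
    push_cast; ring_nf

lemma schCocycle_eq_tm0 (α : ℝ) (f : ℝ → ℝ) (E : ℝ) (n : ℕ) (y : ℝ) :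
    schCocycle α f E n y = tm (fun i => E - f (y + i * α)) 0 n := by
  simpa using schCocycle_eq_tm α f E n 0 y

lemma one_le_norm_sch (α : ℝ) (f : ℝ → ℝ) (E : ℝ) (n : ℕ) (y : ℝ) :
    1 ≤ ‖schCocycle α f E n y‖ := by
  rw [schCocycle_eq_tm0]; exact one_le_norm_tm _ _ _

/-- subadditive averaging -/
lemma subadd_avg (v : ℕ → ℝ) (n : ℕ) (M : ℝ) (s t : ℕ) (hst : s ≤ t)
    (hM : ∀ i, i < t → Real.log (|v i| + 1) ≤ M) (hM0 : 0 ≤ M) :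
    n * Real.log ‖tm v s (t - s)‖ ≤
      ∑ i ∈ Finset.Ico s (t - n), Real.log ‖tm v i n‖ + 2 * n ^ 2 * M := by
  have hlogmul : ∀ a m l, Real.log ‖tm v a (m + l)‖ ≤
      Real.log ‖tm v a m‖ + Real.log ‖tm v (a + m) l‖ := by
    intro a m l
    have h1 := one_le_norm_tm v a m
    have h2 := one_le_norm_tm v (a + m) l
    have h3 := one_le_norm_tm v a (m + l)
    rw [← Real.log_mul (by linarith) (by linarith)]
    apply Real.log_le_log (by linarith)
    rw [tm_add, mul_comm]
    exact norm_mul_le _ _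
  have hlin : ∀ a m, a + m ≤ t → Real.log ‖tm v a m‖ ≤ m * M := by
    intro a m
    induction m with
    | zero => intro _; simp [tm]
    | succ m ih =>
      intro h
      have h1 := hlogmul a m 1
      have h2 : Real.log ‖tm v (a + m) 1‖ ≤ M := by
        simp only [tm, add_zero, mul_one, norm_stepM]
        exact hM _ (by omega)
      have := ih (by omega)
      push_cast
      linarith
  have key : ∀ d s, s + n + d = t → ∑ r ∈ Finset.range n, Real.log ‖tm v (s + r) (t - (s + r))‖ ≤
      ∑ i ∈ Finset.Ico s (t - n), Real.log ‖tm v i n‖ + n ^ 2 * M := by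
    intro d
    induction d with
    | zero =>
      intro s hs
      have : t - n = s := by omega
      rw [this]
      simp only [Finset.Ico_self, Finset.sum_empty, zero_add]
      calc _ ≤ ∑ r ∈ Finset.range n, (n : ℝ) * M := by
            apply Finset.sum_le_sum
            intro r hr
            rw [Finset.mem_range] at hr
            refine (hlin _ _ (by omega)).trans ?_
            apply mul_le_mul_of_nonneg_right _ hM0
            exact_mod_cast (by omega)
        _ = _ := by simp; ring
    | succ d ih =>
      intro s hs
      have h1 := ih (s + 1) (by omega)
      have h2 : Finset.Ico s (t - n) = insert s (Finset.Ico (s + 1) (t - n)) := by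
        rw [Finset.insert_Ico_add_one_left_eq_Ico (by omega)]
      rw [h2, Finset.sum_insert (by simp)]
      have h3 : ∑ r ∈ Finset.range n, Real.log ‖tm v (s + 1 + r) (t - (s + 1 + r))‖ + Real.log ‖tm v s (t - s)‖ =
        ∑ r ∈ Finset.range n, Real.log ‖tm v (s + r) (t - (s + r))‖ + Real.log ‖tm v (s + n) (t - (s + n))‖ := by
        rw [← Finset.sum_range_succ (fun r => Real.log ‖tm v (s + r) (t - (s + r))‖), Finset.sum_range_succ']
        simp only [add_zero]
        congr 1
        apply Finset.sum_congr rfl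
        intro r _
        rw [show s + (r + 1) = s + 1 + r by ring]
      have h4 := hlogmul s n (t - (s + n))
      rw [show n + (t - (s + n)) = t - s by omega] at h4
      linarith
  have hn0 : (0:ℝ) ≤ n := Nat.cast_nonneg n
  have hnn : 0 ≤ (n:ℝ) ^ 2 * M := by positivity
  by_cases h : s + n ≤ t
  · have h1 := key (t - (s + n)) s (by omega)
    have h2 : ∀ r ∈ Finset.range n, Real.log ‖tm v s (t - s)‖ ≤
        n * M + Real.log ‖tm v (s + r) (t - (s + r))‖ := by
      intro r hr
      rw [Finset.mem_range] at hr
      have h4 := hlogmul s r (t - (s + r))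
      rw [show r + (t - (s + r)) = t - s by omega] at h4
      have h5 := hlin s r (by omega)
      have h6 : (r : ℝ) * M ≤ n * M := by
        apply mul_le_mul_of_nonneg_right _ hM0
        exact_mod_cast hr.le
      linarith
    have h3 := Finset.sum_le_sum h2
    rw [Finset.sum_add_distrib] at h3
    simp only [Finset.sum_const, Finset.card_range, nsmul_eq_mul] at h3
    nlinarith
  · have h1 : t - n ≤ s := by omega
    rw [Finset.Ico_eq_empty (by omega), Finset.sum_empty, zero_add]
    have h2 := hlin s (t - s) (by omega)
    have h3 : ((t - s : ℕ) : ℝ) * M ≤ n * M := by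
        apply mul_le_mul_of_nonneg_right _ hM0
        exact_mod_cast (by omega)
    nlinarith
lemma block_close (v : ℕ → ℝ) (n q : ℕ) (hn : 1 ≤ n) (lam ε M D : ℝ) (hlam : 0 ≤ lam) (hε : 0 ≤ ε)
    (hM0 : 0 ≤ M)
    (hG : ∀ a b : ℕ, a ≤ b → b ≤ 3 * q →
      ∑ i ∈ Finset.Ico a b, Real.log ‖tm v i n‖ ≤ ((b : ℝ) - a) * lam + ε * q)
    (hM : ∀ i < 3 * q, Real.log (|v i| + 1) ≤ M)
    (hD : ∑ i ∈ Finset.range (2 * q), |v (i + q) - v i| ≤ D)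
    (s : ℕ) (hs : s ≤ q) :
    ‖tm v (s + q) q - tm v s q‖ ≤ Real.exp ((q * lam + 2 * (ε * q)) / n + 4 * n * M) * D := by
  have hnpos : (0:ℝ) < n := by exact_mod_cast hn
  have hsub : ∀ a t : ℕ, a ≤ t → t ≤ 3 * q →
      Real.log ‖tm v a (t - a)‖ ≤ (((t : ℝ) - a) * lam + ε * q) / n + 2 * n * M := by
    intro a t hat ht
    have h1 := subadd_avg v n M a t hat (fun i hi => hM i (by omega)) hM0
    have h2 : ∑ i ∈ Finset.Ico a (t - n), Real.log ‖tm v i n‖ ≤ ((t : ℝ) - a) * lam + ε * q := by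
      by_cases h : a ≤ t - n
      · refine (hG a (t - n) h (by omega)).trans ?_
        have : ((t - n : ℕ) : ℝ) ≤ t := by exact_mod_cast Nat.sub_le t n
        nlinarith
      · rw [Finset.Ico_eq_empty (by omega), Finset.sum_empty]
        have : (a : ℝ) ≤ t := by exact_mod_cast hat
        have h3 : 0 ≤ ((t : ℝ) - a) * lam := mul_nonneg (by linarith) hlam
        positivity
    have h3 : n * Real.log ‖tm v a (t - a)‖ ≤
        n * ((((t : ℝ) - a) * lam + ε * q) / n + 2 * n * M) := by
      have : n * ((((t : ℝ) - a) * lam + ε * q) / n + 2 * n * M) =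
        (((t : ℝ) - a) * lam + ε * q) + 2 * n ^ 2 * M := by field_simp
      rw [this]; linarith
    exact le_of_mul_le_mul_left h3 hnpos
  have e1 : tm v (s + q) q = tm (fun i => v (i + q)) s q :=
    tm_congr _ _ _ _ _ (fun i => by congr 1; ring)
  rw [e1]
  have hD' : ∑ j ∈ Finset.range q, |(fun i => v (i + q)) (s + j) - v (s + j)| ≤ D := by
    refine le_trans ?_ hD
    rw [← Finset.sum_image (s := Finset.range q) (g := fun j => s + j)
      (f := fun i => |v (i + q) - v i|) (by intro a _ b _ h; simpa using h)]
    apply Finset.sum_le_sum_of_subset_of_nonneg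
    · intro i hi
      simp only [Finset.mem_image, Finset.mem_range] at hi ⊢
      omega
    · intros; positivity
  refine (norm_tm_sub_le v (fun i => v (i + q)) s q
    (Real.exp ((q * lam + 2 * (ε * q)) / n + 4 * n * M)) ?_).trans
    (mul_le_mul_of_nonneg_left hD' (Real.exp_pos _).le)
  intro j hj
  have e2 : tm (fun i => v (i + q)) (s + j + 1) (q - 1 - j) =
      tm v (s + j + 1 + q) ((s + 2 * q) - (s + j + 1 + q)) := by
    rw [show (s + 2 * q) - (s + j + 1 + q) = q - 1 - j by omega]
    exact tm_congr _ _ _ _ _ (fun i => by congr 1; ring)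
  rw [e2]
  have h1 := hsub (s + j + 1 + q) (s + 2 * q) (by omega) (by omega)
  have h2 := hsub s (s + j) (by omega) (by omega)
  rw [show s + j - s = j by omega] at h2
  have p1 := one_le_norm_tm v (s + j + 1 + q) ((s + 2 * q) - (s + j + 1 + q))
  have p2 := one_le_norm_tm v s j
  rw [← Real.exp_log (lt_of_lt_of_le one_pos p1), ← Real.exp_log (lt_of_lt_of_le one_pos p2),
    ← Real.exp_add]
  apply Real.exp_le_exp.mpr
  refine (add_le_add h1 h2).trans ?_
  have : (((s + 2 * q : ℕ) : ℝ) - (s + j + 1 + q : ℕ)) * lam + ε * q +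
      ((((s + j : ℕ) : ℝ) - s) * lam + ε * q) ≤ q * lam + 2 * (ε * q) := by
    push_cast; nlinarith
  have h3 := div_le_div_of_nonneg_right this hnpos.le
  rw [add_div] at h3
  linarith

lemma gordon (A0 A1 A2 : M2) (v0 v1 v2 v3 : Fin 2 → ℂ) (d0 : A0.det = 1) (d1 : A1.det = 1)
    (h1 : A0.mulVec v0 = v1) (h2 : A1.mulVec v1 = v2) (h3 : A2.mulVec v2 = v3)
    (c1 : ‖A1 - A0‖ ≤ 1 / 4) (c2 : ‖A2 - A1‖ ≤ 1 / 4)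
    (n0 : ‖v0‖ ≤ ‖v1‖ / 4) (n2 : ‖v2‖ ≤ ‖v1‖ / 4) (n3 : ‖v3‖ ≤ ‖v1‖ / 4) : v1 = 0 := by
  set t := A1.trace with ht
  have i1 : t • v1 = v2 + v0 + (A1 - A0).adjugate.mulVec v1 := by
    have e0 : v0 = A0.adjugate.mulVec v1 := by
      rw [← h1, Matrix.mulVec_mulVec, Matrix.adjugate_mul, d0]; simp
    rw [e0, ← h2]
    ext i
    rw [Matrix.adjugate_fin_two, Matrix.adjugate_fin_two, ht, Matrix.trace_fin_two]
    fin_cases i <;> simp [dotProduct, Fin.sum_univ_two] <;> ring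
  have i2 : v1 = t • v2 - v3 + (A2 - A1).mulVec v2 := by
    have e1 : A1.mulVec v2 + v1 = t • v2 := by
      have e0 : v1 = A1.adjugate.mulVec v2 := by
        rw [← h2, Matrix.mulVec_mulVec, Matrix.adjugate_mul, d1]; simp
      rw [e0, Matrix.adjugate_fin_two, ht, Matrix.trace_fin_two]
      ext i
      fin_cases i <;> simp [dotProduct, Fin.sum_univ_two] <;> ring
    rw [← e1, ← h3, Matrix.sub_mulVec]; abel
  have j1 : ‖t‖ * ‖v1‖ ≤ ‖v2‖ + ‖v0‖ + 2 * (1 / 4) * ‖v1‖ := by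
    rw [← norm_smul, i1]
    refine (norm_add_le _ _).trans (add_le_add (norm_add_le _ _) ?_)
    refine (Matrix.linfty_opNorm_mulVec _ _).trans
      (mul_le_mul_of_nonneg_right ((norm_adj_le _).trans ?_) (norm_nonneg _))
    linarith
  have j2 : ‖v1‖ ≤ ‖t‖ * ‖v2‖ + ‖v3‖ + 1 / 4 * ‖v2‖ := by
    conv_lhs => rw [i2]
    refine (norm_add_le _ _).trans (add_le_add ((norm_sub_le _ _).trans ?_) ?_)
    · rw [norm_smul]
    · exact (Matrix.linfty_opNorm_mulVec _ _).trans
        (mul_le_mul_of_nonneg_right c2 (norm_nonneg _))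
  by_contra hne
  have hpos : 0 < ‖v1‖ := norm_pos_iff.mpr hne
  have ht1 : ‖t‖ ≤ 1 := by
    have : ‖t‖ * ‖v1‖ ≤ 1 * ‖v1‖ := by linarith
    exact le_of_mul_le_mul_right this hpos
  have : ‖t‖ * ‖v2‖ ≤ 1 * ‖v2‖ := mul_le_mul_of_nonneg_right ht1 (norm_nonneg _)
  linarith

/-! continued fractions -/
lemma gaussIter_irr (α : ℝ) (hα : Irrational α) (k : ℕ) : Irrational (gaussIter α k) := by
  induction k with
  | zero =>
    simp only [gaussIter, Int.fract]
    exact hα.sub_intCast _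
  | succ k ih =>
    simp only [gaussIter, Int.fract]
    exact ih.inv.sub_intCast _

lemma gaussIter_mem (α : ℝ) (hα : Irrational α) (k : ℕ) :
    0 < gaussIter α k ∧ gaussIter α k < 1 := by
  have h := gaussIter_irr α hα k
  have : 0 ≤ gaussIter α k ∧ gaussIter α k < 1 := by
    cases k <;> exact ⟨Int.fract_nonneg _, Int.fract_lt_one _⟩
  exact ⟨lt_of_le_of_ne this.1 (Ne.symm h.ne_zero), this.2⟩

lemma gaussIter_inv (α : ℝ) (hα : Irrational α) (k : ℕ) :
    (gaussIter α k)⁻¹ = cfA α k + gaussIter α (k + 1) := by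
  have h := gaussIter_mem α hα k
  have h2 : (⌊(gaussIter α k)⁻¹⌋₊ : ℝ) = ⌊(gaussIter α k)⁻¹⌋ := by
    have := Int.natCast_floor_eq_floor (inv_nonneg.mpr h.1.le)
    exact_mod_cast this
  rw [cfA, h2, gaussIter, Int.floor_add_fract]

lemma cfA_pos (α : ℝ) (hα : Irrational α) (k : ℕ) : 1 ≤ cfA α k := by
  have h := gaussIter_mem α hα k
  rw [cfA, Nat.one_le_floor_iff]
  exact (one_le_inv₀ h.1).mpr h.2.le

lemma cfDen_pos (α : ℝ) (hα : Irrational α) : ∀ k, 1 ≤ cfDen α k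
  | 0 => le_refl _
  | 1 => cfA_pos α hα 0
  | (k+2) => by
    have := cfDen_pos α hα k
    rw [cfDen]; omega

lemma le_cfDen (α : ℝ) (hα : Irrational α) : ∀ k, k ≤ cfDen α k
  | 0 => Nat.zero_le _
  | 1 => cfDen_pos α hα 1
  | (k+2) => by
    have h1 := cfDen_pos α hα k
    have h2 := le_cfDen α hα (k+1)
    have h3 := cfA_pos α hα (k+1)
    rw [cfDen]
    nlinarith

lemma cfDen_tendsto (α : ℝ) (hα : Irrational α) : Tendsto (cfDen α) atTop atTop :=
  tendsto_atTop_mono (le_cfDen α hα) tendsto_id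

lemma cf_approx (α : ℝ) (hα : Irrational α) (k : ℕ) :
    ∃ p : ℤ, |cfDen α k * α - p| ≤ 1 / cfDen α (k + 1) := by
  set P : ℕ → ℝ := fun k => ∏ i ∈ Finset.range (k + 1), gaussIter α i with hP
  have hPpos : ∀ k, 0 < P k := fun k => Finset.prod_pos fun i _ => (gaussIter_mem α hα i).1
  have hrec : ∀ k, P (k + 2) = P k - cfA α (k + 1) * P (k + 1) := by
    intro k
    have h1 : P (k + 1) = P k * gaussIter α (k + 1) := Finset.prod_range_succ _ _
    have h2 : P (k + 2) = P (k + 1) * gaussIter α (k + 2) := Finset.prod_range_succ _ _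
    have h3 := gaussIter_inv α hα (k + 1)
    have h4 := (gaussIter_mem α hα (k + 1)).1
    have h5 : gaussIter α (k + 2) = (gaussIter α (k + 1))⁻¹ - cfA α (k + 1) := by linarith
    rw [h2, h1, h5]
    field_simp
  have hP0 : P 0 = gaussIter α 0 := by simp [hP]
  have hP1 : P 1 = gaussIter α 0 * gaussIter α 1 := by simp [hP, Finset.prod_range_succ]
  have h01 : gaussIter α 0 * (cfA α 0 + gaussIter α 1) = 1 := by
    have h3 := gaussIter_inv α hα 0
    have h4 := (gaussIter_mem α hα 0).1
    rw [← h3, mul_inv_cancel₀ h4.ne']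
  have I : ∀ k, (∃ p : ℤ, cfDen α k * α - p = (-1) ^ k * P k) ∧
      (∃ p : ℤ, cfDen α (k + 1) * α - p = (-1) ^ (k + 1) * P (k + 1)) := by
    intro k
    induction k with
    | zero =>
      refine ⟨⟨⌊α⌋, ?_⟩, ⟨cfA α 0 * ⌊α⌋ + 1, ?_⟩⟩
      · rw [hP0]; simp [cfDen, gaussIter]
      · rw [hP1]
        simp only [cfDen, zero_add, pow_one]
        have : α = ⌊α⌋ + gaussIter α 0 := by simp [gaussIter]
        push_cast
        linear_combination (cfA α 0 : ℝ) * this + h01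
    | succ k ih =>
      obtain ⟨⟨p, hp⟩, ⟨p', hp'⟩⟩ := ih
      refine ⟨⟨p', hp'⟩, ⟨cfA α (k + 1) * p' + p, ?_⟩⟩
      rw [hrec, cfDen]
      push_cast
      have e1 : (-1 : ℝ) ^ (k + 1 + 1) = (-1) ^ k := by ring
      have e2 : (-1 : ℝ) ^ (k + 1) = - (-1) ^ k := by ring
      rw [e1]
      rw [e2] at hp'
      linear_combination (cfA α (k + 1) : ℝ) * hp' + hp
  have J : ∀ k, cfDen α (k + 1) * P k + cfDen α k * P (k + 1) = 1 := by
    intro k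
    induction k with
    | zero =>
      rw [hP0, zero_add, hP1]
      simp only [cfDen]
      push_cast
      linarith
    | succ k ih =>
      rw [hrec, cfDen]
      push_cast
      linear_combination ih
  obtain ⟨⟨p, hp⟩, -⟩ := I k
  refine ⟨p, ?_⟩
  rw [hp, abs_mul, abs_pow, abs_neg, abs_one, one_pow, one_mul, abs_of_pos (hPpos k)]
  have hq : (0:ℝ) < cfDen α (k + 1) := by exact_mod_cast cfDen_pos α hα (k + 1)
  rw [le_div_iff₀ hq]
  have := J k
  have h2 : 0 ≤ cfDen α k * P (k + 1) := mul_nonneg (Nat.cast_nonneg _) (hPpos _).le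
  linarith
/-- the base probability measure -/
abbrev mu01 : Measure ℝ := volume.restrict (Set.Ico (0:ℝ) 1)

lemma lintegral_shift (F : ℝ → ℝ≥0∞) (hp : Function.Periodic F 1) (c : ℝ) :
    ∫⁻ x, F (x + c) ∂mu01 = ∫⁻ x, F x ∂mu01 := by
  have h1 : ∀ t : ℝ, ∫⁻ x in Set.Ico t (t + 1), F x = ∫⁻ b : UnitAddCircle, hp.lift b := by
    intro t
    rw [setLIntegral_congr Ico_ae_eq_Ioc, ← UnitAddCircle.lintegral_preimage t]
    simp
  have h2 := h1 0
  rw [zero_add] at h2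
  rw [h2, ← h1 c]
  have := (measurePreserving_add_right (volume : Measure ℝ) c).setLIntegral_comp_emb
    (MeasurableEquiv.addRight c).measurableEmbedding F (Set.Ico (0:ℝ) 1)
  simpa [add_comm] using this

lemma weyl (α : ℝ) (hα : Irrational α) (φ : C(UnitAddCircle, ℂ)) : ∀ ε > 0, ∃ C : ℝ,
    ∀ (x : ℝ) (N : ℕ), ‖∑ i ∈ Finset.range N, φ ((x + i * α : ℝ) : UnitAddCircle)
      - N * ∫ b : UnitAddCircle, φ b‖ ≤ ε * N + C := by
  have hintg : ∀ φ : C(UnitAddCircle, ℂ), Integrable φ := fun φ =>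
    φ.continuous.integrable_of_hasCompactSupport (HasCompactSupport.of_compactSpace _)
  have hmem : φ ∈ (Submodule.span ℂ (Set.range (@fourier 1))).topologicalClosure := by
    rw [span_fourier_closure_eq_top]; trivial
  have hspan : ∀ φ ∈ Submodule.span ℂ (Set.range (@fourier 1)), ∃ C : ℝ,
    ∀ (x : ℝ) (N : ℕ), ‖∑ i ∈ Finset.range N, φ ((x + i * α : ℝ) : UnitAddCircle)
      - N * ∫ b : UnitAddCircle, φ b‖ ≤ C := by
    intro φ hφ
    induction hφ using Submodule.span_induction with
    | mem φ h =>
      obtain ⟨n, rfl⟩ := h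
      by_cases hn : n = 0
      · subst hn
        refine ⟨0, fun x N => ?_⟩
        simp [Measure.real]
      · have h0 : ∫ b : UnitAddCircle, (fourier n b : ℂ) = 0 := by
          have h := fourier_add_half_inv_index (T := 1) hn one_pos
          exact integral_eq_zero_of_add_right_eq_neg (μ := (volume : Measure UnitAddCircle)) h
        set z : ℂ := Complex.exp (2 * Real.pi * Complex.I * n * α) with hz
        have hz1 : z ≠ 1 := by
          intro h
          rw [hz, Complex.exp_eq_one_iff] at h
          obtain ⟨m, hm⟩ := h
          have hne : (2 * Real.pi * Complex.I : ℂ) ≠ 0 := Complex.two_pi_I_ne_zero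
          have h3 : (n : ℂ) * α = m := by
            apply mul_left_cancel₀ hne
            linear_combination hm
          have h4 : (n : ℝ) * α = m := by exact_mod_cast h3
          have := (hα.intCast_mul hn)
          rw [h4] at this
          exact Int.not_irrational m this
        have hzn : ‖z‖ = 1 := by
          rw [hz, show (2 * Real.pi * Complex.I * n * α : ℂ) = ((2 * Real.pi * n * α : ℝ) : ℂ) * Complex.I by
            push_cast; ring]
          exact Complex.norm_exp_ofReal_mul_I _
        refine ⟨2 / ‖z - 1‖, fun x N => ?_⟩
        rw [h0, mul_zero, sub_zero]
        have e : ∀ i ∈ Finset.range N, (fourier n ((x + i * α : ℝ) : UnitAddCircle) : ℂ) =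
            fourier n (x : UnitAddCircle) * z ^ i := by
          intro i _
          rw [fourier_coe_apply, fourier_coe_apply, hz, ← Complex.exp_nat_mul, ← Complex.exp_add]
          congr 1
          push_cast
          ring
        rw [Finset.sum_congr rfl e, ← Finset.mul_sum, norm_mul, geom_sum_eq hz1, norm_div]
        have e2 : ‖(fourier n (x : UnitAddCircle) : ℂ)‖ = 1 := by
          rw [fourier_apply]; exact Circle.norm_coe _
        rw [e2, one_mul]
        apply div_le_div_of_nonneg_right _ (norm_nonneg _)
        refine (norm_sub_le _ _).trans ?_
        rw [norm_pow, hzn]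
        norm_num
    | zero => exact ⟨0, fun x N => by simp⟩
    | add φ1 φ2 _ _ h1 h2 =>
      obtain ⟨C1, h1⟩ := h1
      obtain ⟨C2, h2⟩ := h2
      refine ⟨C1 + C2, fun x N => ?_⟩
      have : ∫ b : UnitAddCircle, (φ1 + φ2) b = (∫ b : UnitAddCircle, φ1 b) + ∫ b : UnitAddCircle, φ2 b :=
        integral_add (hintg _) (hintg _)
      rw [this]
      simp only [ContinuousMap.add_apply, Finset.sum_add_distrib]
      refine le_trans ?_ (add_le_add (h1 x N) (h2 x N))
      refine le_trans (le_of_eq ?_) (norm_add_le _ _)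
      congr 1; ring
    | smul c φ _ h =>
      obtain ⟨C1, h1⟩ := h
      refine ⟨‖c‖ * C1, fun x N => ?_⟩
      have : ∫ b : UnitAddCircle, (c • φ) b = c * (∫ b : UnitAddCircle, φ b) :=
        integral_const_mul c _
      rw [this]
      simp only [ContinuousMap.smul_apply, smul_eq_mul, ← Finset.mul_sum]
      refine le_trans (le_of_eq ?_) (mul_le_mul_of_nonneg_left (h1 x N) (norm_nonneg c))
      rw [← norm_mul]
      congr 1; ring
  intro ε hε
  obtain ⟨ψ, hψ, hd⟩ := Metric.mem_closure_iff.mp hmem (ε / 2) (by linarith)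
  obtain ⟨C, hC⟩ := hspan ψ hψ
  refine ⟨C, fun x N => ?_⟩
  have hpt : ∀ b, ‖φ b - ψ b‖ ≤ ε / 2 := by
    intro b
    rw [← dist_eq_norm]
    exact (ContinuousMap.dist_apply_le_dist b).trans hd.le
  have hI : ‖(∫ b : UnitAddCircle, φ b) - ∫ b : UnitAddCircle, ψ b‖ ≤ ε / 2 := by
    rw [← integral_sub (hintg _) (hintg _)]
    refine (norm_integral_le_of_norm_le_const (C := ε / 2) (Eventually.of_forall hpt)).trans ?_
    simp [Measure.real]
  have hS : ‖∑ i ∈ Finset.range N, (φ ((x + i * α : ℝ) : UnitAddCircle) -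
      ψ ((x + i * α : ℝ) : UnitAddCircle))‖ ≤ N * (ε / 2) := by
    refine (norm_sum_le _ _).trans ?_
    refine (Finset.sum_le_sum (fun i _ => hpt _)).trans ?_
    simp
  rw [Finset.sum_sub_distrib] at hS
  have hN : ‖(N : ℂ) * ((∫ b : UnitAddCircle, φ b) - ∫ b : UnitAddCircle, ψ b)‖ ≤ N * (ε / 2) := by
    rw [norm_mul]
    simp only [Complex.norm_natCast]
    exact mul_le_mul_of_nonneg_left hI (Nat.cast_nonneg _)
  have h3 := hC x N
  calc _ = ‖(∑ i ∈ Finset.range N, φ ((x + i * α : ℝ) : UnitAddCircle) -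
        ∑ i ∈ Finset.range N, ψ ((x + i * α : ℝ) : UnitAddCircle)) +
      (∑ i ∈ Finset.range N, ψ ((x + i * α : ℝ) : UnitAddCircle) - N * ∫ b : UnitAddCircle, ψ b) -
      (N : ℂ) * ((∫ b : UnitAddCircle, φ b) - ∫ b : UnitAddCircle, ψ b)‖ := by congr 1; ring
    _ ≤ N * (ε / 2) + C + N * (ε / 2) := by
      refine (norm_sub_le _ _).trans (add_le_add ((norm_add_le _ _).trans (add_le_add hS h3)) hN)
    _ = _ := by ring

lemma approx (α : ℝ) (hα : Irrational α) (G : ℝ → ℝ) (hm : Measurable G)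
    (hp : Function.Periodic G 1) (hi : Integrable G mu01) (ε : ℝ) (hε : 0 < ε) :
    ∃ φ : ℝ → ℝ, Measurable φ ∧ Function.Periodic φ 1 ∧
      ∫⁻ x, ENNReal.ofReal |G x - φ x| ∂mu01 ≤ ENNReal.ofReal ε ∧
      ∃ C : ℝ, ∀ (x : ℝ) (N : ℕ), ∑ i ∈ Finset.range N, φ (x + i * α) ≤
        N * ((∫ x, G x ∂mu01) + ε) + C := by
  set g : UnitAddCircle → ℝ := hp.lift with hg
  have hgm : Measurable g := by
    rw [QuotientAddGroup.measurable_from_quotient]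
    exact hm
  have hmp : MeasurePreserving ((↑) : ℝ → UnitAddCircle) mu01 volume := by
    have := UnitAddCircle.measurePreserving_mk 0
    rw [zero_add] at this
    rwa [mu01, restrict_Ico_eq_restrict_Ioc]
  have hgi : Integrable g := by
    rw [← hmp.integrable_comp hgm.aestronglyMeasurable]
    exact hi
  have hgint : ∫ x, G x ∂mu01 = ∫ b, g b := by
    rw [← hmp.map_eq, integral_map hmp.measurable.aemeasurable hgm.aestronglyMeasurable]
    rfl
  obtain ⟨h, -, hh, hc, hhi⟩ := hgi.exists_hasCompactSupport_integral_sub_le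
    (ε := ε / 2) (by linarith)
  let H : C(UnitAddCircle, ℂ) := ⟨fun b => (h b : ℂ), Complex.continuous_ofReal.comp hc⟩
  obtain ⟨C, hC⟩ := weyl α hα H (ε / 2) (by linarith)
  refine ⟨fun x => h (x : UnitAddCircle), hc.measurable.comp hmp.measurable, ?_, ?_, C, ?_⟩
  · intro x
    simp
  · have : ∫⁻ x, ENNReal.ofReal |G x - h (x : UnitAddCircle)| ∂mu01 =
        ∫⁻ b : UnitAddCircle, ENNReal.ofReal ‖g b - h b‖ := by
      rw [← hmp.map_eq, lintegral_map _ hmp.measurable]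
      · rfl
      · exact (hgm.sub hc.measurable).norm.ennreal_ofReal
    have h7 := ofReal_integral_eq_lintegral_ofReal (f := fun b => ‖g b - h b‖) (hgi.sub hhi).norm
      (Eventually.of_forall fun _ => norm_nonneg _)
    rw [this, ← h7]
    exact ENNReal.ofReal_le_ofReal (hh.trans (by linarith))
  · intro x N
    have h1 := hC x N
    have h2 : ∫ b : UnitAddCircle, H b = ((∫ b : UnitAddCircle, h b : ℝ) : ℂ) := integral_ofReal
    have h3 : ∑ i ∈ Finset.range N, H ((x + i * α : ℝ) : UnitAddCircle) =
      ((∑ i ∈ Finset.range N, h ((x + i * α : ℝ) : UnitAddCircle) : ℝ) : ℂ) := by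
      push_cast; rfl
    rw [h2, h3, ← Complex.ofReal_natCast, ← Complex.ofReal_mul, ← Complex.ofReal_sub,
      Complex.norm_real, Real.norm_eq_abs] at h1
    have h4 := (abs_le.mp h1).2
    have h5 : ∫ b : UnitAddCircle, h b ≤ (∫ x, G x ∂mu01) + ε / 2 := by
      rw [hgint]
      have : (∫ b : UnitAddCircle, h b) - ∫ b, g b ≤ ε / 2 := by
        rw [← integral_sub hhi hgi]
        refine le_trans (integral_mono (hhi.sub hgi) (hgi.sub hhi).norm ?_) hh
        intro b
        simp only [Pi.sub_apply]
        rw [norm_sub_rev]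
        exact le_abs_self _
      linarith
    have h6 : (N : ℝ) * ∫ b : UnitAddCircle, h b ≤ N * ((∫ x, G x ∂mu01) + ε / 2) :=
      mul_le_mul_of_nonneg_left h5 (Nat.cast_nonneg _)
    simp only
    nlinarith
lemma markov_sum (F : ℝ → ℝ≥0∞) (hm : Measurable F) (hp : Function.Periodic F 1)
    (s : Finset ℕ) (c : ℕ → ℝ) (t : ℝ≥0∞) (h0 : t ≠ 0) (ht : t ≠ ⊤) :
    mu01 {x | t ≤ ∑ i ∈ s, F (x + c i)} ≤ (s.card * ∫⁻ x, F x ∂mu01) / t := by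
  have hm' : ∀ i, Measurable fun x => F (x + c i) := fun i => hm.comp (measurable_add_const _)
  refine (meas_ge_le_lintegral_div (Finset.measurable_sum _ fun i _ => hm' i).aemeasurable
    h0 ht).trans ?_
  rw [lintegral_finsetSum _ fun i _ => hm' i]
  simp only [lintegral_shift F hp, Finset.sum_const, nsmul_eq_mul]
  exact le_refl _

lemma event1 (α : ℝ) (hα : Irrational α) (G : ℝ → ℝ) (hm : Measurable G)
    (hp : Function.Periodic G 1) (hi : Integrable G mu01) (ε : ℝ) (hε : 0 < ε) :
    Tendsto (fun q : ℕ => mu01 {x | ¬ ∀ a b : ℕ, a ≤ b → b ≤ 3 * q →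
      ∑ i ∈ Finset.Ico a b, G (x - q * α + i * α) ≤
        ((b : ℝ) - a) * (∫ x, G x ∂mu01) + ε * q}) atTop (nhds 0) := by
  rw [ENNReal.tendsto_nhds_zero]
  intro η hη
  obtain ⟨η', hη', hη'2⟩ : ∃ η' : ℝ, 0 < η' ∧ ENNReal.ofReal η' ≤ η := by
    by_cases h : η = ⊤
    · exact ⟨1, one_pos, h ▸ le_top⟩
    · exact ⟨η.toReal, ENNReal.toReal_pos hη.ne' h, (ENNReal.ofReal_toReal h).le⟩
  set e := min (ε / 12) (η' * ε / 6) with he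
  have hepos : 0 < e := lt_min (by positivity) (by positivity)
  have he1 : e ≤ ε / 12 := min_le_left _ _
  have he2 : e ≤ η' * ε / 6 := min_le_right _ _
  obtain ⟨φ, φm, φp, hφ, C, hC⟩ := approx α hα G hm hp hi e hepos
  obtain ⟨Q, hQ⟩ := exists_nat_ge (|C| * 4 / ε)
  filter_upwards [eventually_ge_atTop (Q + 1)] with q hq
  have hqpos : (0:ℝ) < q := by exact_mod_cast (by omega : 0 < q)
  have hCq : C ≤ ε * q / 4 := by
    have : (Q : ℝ) ≤ q := by exact_mod_cast (by omega : Q ≤ q)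
    have h1 : |C| * 4 / ε ≤ q := hQ.trans this
    rw [div_le_iff₀ hε] at h1
    linarith [le_abs_self C]
  set F : ℝ → ℝ≥0∞ := fun x => ENNReal.ofReal |G x - φ x| with hF
  have hFm : Measurable F := (hm.sub φm).norm.ennreal_ofReal
  have hFp : Function.Periodic F 1 := fun x => by simp only [hF, hp x, φp x]
  have hmark := markov_sum F hFm hFp (Finset.range (3 * q)) (fun i => - (q * α) + i * α)
    (ENNReal.ofReal (ε * q / 2)) (by simp; positivity) ENNReal.ofReal_ne_top
  refine le_trans (measure_mono ?_) (hmark.trans ?_)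
  · intro x hx
    simp only [Set.mem_ofPred_eq] at hx ⊢
    push Not at hx
    obtain ⟨a, b, hab, hb, hx⟩ := hx
    simp only [hF]
    rw [← ENNReal.ofReal_sum_of_nonneg (fun _ _ => abs_nonneg _)]
    apply ENNReal.ofReal_le_ofReal
    have h1 : ∑ i ∈ Finset.Ico a b, φ (x - q * α + i * α) ≤
        ((b : ℝ) - a) * (∫ x, G x ∂mu01) + 3 * q * e + C := by
      have := hC (x - q * α + a * α) (b - a)
      rw [Finset.sum_Ico_eq_sum_range]
      have e1 : ∀ i ∈ Finset.range (b - a), φ (x - q * α + ((a + i : ℕ) : ℝ) * α) =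
          φ (x - q * α + a * α + i * α) := by
        intro i _; congr 1; push_cast; ring
      rw [Finset.sum_congr rfl e1]
      refine this.trans ?_
      rw [Nat.cast_sub hab]
      have h3 : ((b : ℝ) - a) * e ≤ 3 * q * e := by
        apply mul_le_mul_of_nonneg_right _ hepos.le
        have : (b : ℝ) ≤ 3 * q := by exact_mod_cast hb
        have : (0 : ℝ) ≤ a := Nat.cast_nonneg a
        linarith
      linarith
    have h2 : ∑ i ∈ Finset.Ico a b, (G (x - q * α + i * α) - φ (x - q * α + i * α)) ≤
        ∑ i ∈ Finset.range (3 * q), |G (x + (-(q * α) + i * α)) - φ (x + (-(q * α) + i * α))| := by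
      calc _ ≤ ∑ i ∈ Finset.Ico a b, |G (x + (-(q * α) + i * α)) - φ (x + (-(q * α) + i * α))| := by
            apply Finset.sum_le_sum
            intro i _
            rw [show x - q * α + i * α = x + (-(q * α) + i * α) by ring]
            exact le_abs_self _
        _ ≤ _ := by
          apply Finset.sum_le_sum_of_subset_of_nonneg
          · intro i hi
            simp only [Finset.mem_Ico, Finset.mem_range] at hi ⊢
            omega
          · intros; positivity
    rw [Finset.sum_sub_distrib] at h2
    have h3 : 3 * q * e ≤ ε * q / 4 := by nlinarith
    linarith
  · refine le_trans ?_ hη'2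
    apply ENNReal.div_le_of_le_mul
    rw [← ENNReal.ofReal_mul hη'.le, Finset.card_range]
    refine (mul_le_mul_right hφ _).trans ?_
    rw [← ENNReal.ofReal_natCast, ← ENNReal.ofReal_mul (Nat.cast_nonneg _)]
    apply ENNReal.ofReal_le_ofReal
    push_cast
    nlinarith

lemma pVar_translate (h : ℝ → ℝ) (hp : Function.Periodic h 1) (n : ℕ) :
    eVariationOn h (Set.Icc 0 n) ≤ n * pVar h := by
  induction n with
  | zero => simp
  | succ n ih =>
    have h1 := eVariationOn.Icc_add_Icc h (s := Set.univ) (a := (0:ℝ)) (b := n) (c := n + 1)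
      (Nat.cast_nonneg n) (by linarith) trivial
    simp only [Set.univ_inter] at h1
    push_cast
    rw [← h1, add_mul, one_mul]
    refine add_le_add ih ?_
    have h2 := eVariationOn.comp_le_of_monotoneOn h (s := Set.Icc (0:ℝ) 1) (t := Set.Icc (n:ℝ) (n+1))
    have : eVariationOn h (Set.Icc (n:ℝ) (n+1)) = eVariationOn (h ∘ fun x => x - n) (Set.Icc (n:ℝ) (n+1)) := by
      apply eVariationOn.congr
      intro x _
      simp only [Function.comp]
      have := hp.sub_nat_mul_eq (x := x) n
      simp at this
      exact this.symm
    rw [this]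
    apply eVariationOn.comp_le_of_monotoneOn h
    · intro x _ y _ hxy; simpa using hxy
    · intro x hx
      simp only [Set.mem_Icc] at hx ⊢
      constructor <;> linarith [hx.1, hx.2]

lemma shift_var_pos (h : ℝ → ℝ) (hm : Measurable h) (hp : Function.Periodic h 1) (θ : ℝ)
    (h0 : 0 < θ) (h1 : θ ≤ 1) :
    ∫⁻ x, ENNReal.ofReal |h (x + θ) - h x| ∂mu01 ≤ 3 * pVar h * ENNReal.ofReal θ := by
  set F : ℝ → ℝ≥0∞ := fun x => ENNReal.ofReal |h (x + θ) - h x| with hF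
  have hFm : Measurable F := ((hm.comp (measurable_add_const _)).sub hm).norm.ennreal_ofReal
  have hFp : Function.Periodic F 1 := fun x => by
    simp only [hF, hp x]
    rw [show x + 1 + θ = (x + θ) + 1 by ring, hp]
  set N := ⌈1 / θ⌉₊ with hN
  have hN1 : 1 / θ ≤ N := Nat.le_ceil _
  have hN2 : (N : ℝ) < 1 / θ + 1 := Nat.ceil_lt_add_one (by positivity)
  have hNθ : 1 ≤ N * θ := by rwa [div_le_iff₀ h0] at hN1
  have hNθ2 : N * θ ≤ 2 := by
    have : (N : ℝ) * θ ≤ (1 / θ + 1) * θ := mul_le_mul_of_nonneg_right hN2.le h0.le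
    rw [add_mul, one_div_mul_cancel h0.ne'] at this
    linarith
  have hsum : N * ∫⁻ x, F x ∂mu01 = ∫⁻ x, ∑ i ∈ Finset.range N, F (x + i * θ) ∂mu01 := by
    have hm' : ∀ i : ℕ, Measurable fun x => F (x + i * θ) :=
      fun i => hFm.comp (measurable_add_const _)
    rw [lintegral_finsetSum _ fun i _ => hm' i]
    simp only [lintegral_shift F hFp, Finset.sum_const, Finset.card_range, nsmul_eq_mul]
  have hle : ∫⁻ x, ∑ i ∈ Finset.range N, F (x + i * θ) ∂mu01 ≤ ∫⁻ x, 3 * pVar h ∂mu01 := by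
    apply setLIntegral_mono' measurableSet_Ico
    intro x hx
    have h3 := pVar_translate h hp 3
    refine le_trans ?_ h3
    have := eVariationOn.sum_le_of_monotoneOn_Iic (f := h) (s := Set.Icc (0:ℝ) (3:ℕ)) (n := N)
      (u := fun i => x + i * θ) ?_ ?_
    · refine le_trans (le_of_eq (Finset.sum_congr rfl ?_)) this
      intro i _
      rw [edist_dist, Real.dist_eq]
      simp only [hF]
      congr 4
      push_cast; ring
    · intro i _ j _ hij
      have : (i : ℝ) ≤ j := by exact_mod_cast hij
      simp only
      nlinarith
    · intro i hi
      have : (i : ℝ) ≤ N := by exact_mod_cast hi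
      have h5 : (i : ℝ) * θ ≤ N * θ := mul_le_mul_of_nonneg_right this h0.le
      have h6 : 0 ≤ (i : ℝ) * θ := by positivity
      constructor
      · linarith [hx.1]
      · push_cast; linarith [hx.2]
  rw [← hsum] at hle
  simp only [lintegral_const, Measure.restrict_apply_univ, Real.volume_Ico, sub_zero,
    ENNReal.ofReal_one, mul_one] at hle
  calc ∫⁻ x, F x ∂mu01 ≤ (ENNReal.ofReal (N * θ)) * ∫⁻ x, F x ∂mu01 := by
        conv_lhs => rw [← one_mul (∫⁻ x, F x ∂mu01)]
        gcongr
        rw [← ENNReal.ofReal_one]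
        exact ENNReal.ofReal_le_ofReal hNθ
    _ = (N * ∫⁻ x, F x ∂mu01) * ENNReal.ofReal θ := by
        rw [ENNReal.ofReal_mul (Nat.cast_nonneg _), ENNReal.ofReal_natCast]; ring
    _ ≤ _ := by gcongr

lemma shift_var (h : ℝ → ℝ) (hm : Measurable h) (hp : Function.Periodic h 1) (θ : ℝ)
    (h1 : |θ| ≤ 1) :
    ∫⁻ x, ENNReal.ofReal |h (x + θ) - h x| ∂mu01 ≤ 3 * pVar h * ENNReal.ofReal |θ| := by
  rcases lt_trichotomy θ 0 with hθ | hθ | hθ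
  · have h2 := shift_var_pos h hm hp (-θ) (by linarith) (by rwa [abs_of_neg hθ] at h1)
    rw [abs_of_neg hθ]
    refine le_trans (le_of_eq ?_) h2
    have h3 := lintegral_shift (fun x => ENNReal.ofReal |h (x + -θ) - h x|) (fun x => by
      simp only [hp x]
      rw [show x + 1 + -θ = (x + -θ) + 1 by ring, hp]) θ
    rw [← h3]
    apply lintegral_congr
    intro x
    rw [abs_sub_comm, show x + θ + -θ = x by ring]
  · subst hθ; simp
  · rw [abs_of_pos hθ] at h1 ⊢
    exact shift_var_pos h hm hp θ hθ h1

lemma pVar_trunc (f : ℝ → ℝ) (B : ℝ) (hB : 1 ≤ B) :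
    pVar (trunc f B) ≤ sVar f * ENNReal.ofReal B := by
  have h : (ENNReal.ofReal B)⁻¹ * pVar (trunc f B) ≤ sVar f :=
    le_iSup (fun B : {B : ℝ // 1 ≤ B} => (ENNReal.ofReal B.1)⁻¹ * pVar (trunc f B.1)) ⟨B, hB⟩
  have h0 : ENNReal.ofReal B ≠ 0 := by simp; linarith
  calc pVar (trunc f B) = ((ENNReal.ofReal B)⁻¹ * pVar (trunc f B)) * ENNReal.ofReal B := by
        rw [mul_comm, ← mul_assoc, ENNReal.mul_inv_cancel h0 ENNReal.ofReal_ne_top, one_mul]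
    _ ≤ _ := by gcongr

/-- Difference event for one scale. -/
lemma event3 (α : ℝ) (f : ℝ → ℝ) (hmeas : Measurable f) (hper : Function.Periodic f 1)
    (q : ℕ) (θ : ℝ) (p : ℤ) (hθ : q * α = p + θ) (h1 : |θ| ≤ 1) (B t : ℝ) (hB : 1 ≤ B) (ht : 0 < t) :
    mu01 {x | (∀ i < 3 * q, |f (x - q * α + i * α)| ≤ B) ∧
      t < ∑ i ∈ Finset.range (2 * q),
        |f (x - q * α + ((i + q : ℕ) : ℝ) * α) - f (x - q * α + i * α)|} ≤
      6 * q * sVar f * ENNReal.ofReal (B * |θ| / t) := by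
  set h := trunc f B with hh
  have hm : Measurable h :=
    Measurable.ite (measurableSet_le hmeas.norm measurable_const) hmeas measurable_const
  have hp : Function.Periodic h 1 := fun x => by simp only [hh, trunc, hper x]
  set F : ℝ → ℝ≥0∞ := fun x => ENNReal.ofReal |h (x + θ) - h x| with hF
  have hFm : Measurable F := ((hm.comp (measurable_add_const _)).sub hm).norm.ennreal_ofReal
  have hFp : Function.Periodic F 1 := fun x => by
    simp only [hF, hp x]
    rw [show x + 1 + θ = (x + θ) + 1 by ring, hp]
  have hmark := markov_sum F hFm hFp (Finset.range (2 * q)) (fun i => - (q * α) + i * α)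
    (ENNReal.ofReal t) (by simp; positivity) ENNReal.ofReal_ne_top
  refine le_trans (measure_mono ?_) (hmark.trans ?_)
  · rintro x ⟨hx1, hx2⟩
    simp only [Set.mem_ofPred_eq, hF]
    rw [← ENNReal.ofReal_sum_of_nonneg (fun _ _ => abs_nonneg _)]
    apply ENNReal.ofReal_le_ofReal
    refine hx2.le.trans (le_of_eq (Finset.sum_congr rfl ?_))
    intro i hi
    rw [Finset.mem_range] at hi
    have e1 : h (x + (-(q * α) + i * α)) = f (x - q * α + i * α) := by
      rw [show x + (-(q * α) + i * α) = x - q * α + i * α by ring]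
      simp only [hh, trunc, if_pos (hx1 i (by omega))]
    have e2 : h (x + (-(q * α) + i * α) + θ) = f (x - q * α + ((i + q : ℕ) : ℝ) * α) := by
      have e3 : x - q * α + ((i + q : ℕ) : ℝ) * α = x + (-(q * α) + i * α) + θ + p * 1 := by
        push_cast; linear_combination hθ
      have e4 : h (x - q * α + ((i + q : ℕ) : ℝ) * α) = f (x - q * α + ((i + q : ℕ) : ℝ) * α) := by
        simp only [hh, trunc, if_pos (hx1 (i + q) (by omega))]
      rw [← e4, e3]
      exact ((hp.int_mul p) _).symm
    rw [e1, e2]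
  · rw [Finset.card_range]
    apply ENNReal.div_le_of_le_mul
    have h2 := shift_var h hm hp θ h1
    have h3 := pVar_trunc f B hB
    have e5 : ENNReal.ofReal (B * |θ| / t) * ENNReal.ofReal t = ENNReal.ofReal B * ENNReal.ofReal |θ| := by
      rw [← ENNReal.ofReal_mul (by positivity), ← ENNReal.ofReal_mul (by positivity)]
      congr 1; field_simp
    rw [mul_assoc, e5]
    calc _ ≤ ((2 * q : ℕ) : ℝ≥0∞) * (3 * (sVar f * ENNReal.ofReal B) * ENNReal.ofReal |θ|) := by
          gcongr
          exact h2.trans (by gcongr)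
      _ = _ := by push_cast; ring
lemma event2 (α : ℝ) (hα : Irrational α) (f : ℝ → ℝ) (hmeas : Measurable f)
    (hper : Function.Periodic f 1)
    (hlog : Integrable (fun x => Real.log (1 + |f x|)) mu01) (η : ℝ) (hη : 0 < η) :
    Tendsto (fun q : ℕ => mu01 {x | ¬ ∀ i < 3 * q, |f (x - q * α + i * α)| ≤ Real.exp (η * q)})
      atTop (nhds 0) := by
  have hm : Measurable (fun x => Real.log (1 + |f x|)) :=
    Real.measurable_log.comp (measurable_const.add hmeas.norm)
  have h1 := event1 α hα (fun x => Real.log (1 + |f x|)) hm (fun x => by simp only [hper x]) hlog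
    (η / 2) (by linarith)
  refine tendsto_of_tendsto_of_tendsto_of_le_of_le' tendsto_const_nhds h1
    (Eventually.of_forall fun _ => zero_le) ?_
  set I := ∫ x, Real.log (1 + |f x|) ∂mu01 with hI
  obtain ⟨Q, hQ⟩ := exists_nat_ge (I / (η / 2))
  filter_upwards [eventually_ge_atTop Q] with q hq
  apply measure_mono
  intro x hx
  simp only [Set.mem_ofPred_eq] at hx ⊢
  contrapose! hx
  intro i hi
  have h2 := hx i (i + 1) (by omega) (by omega)
  simp only [Nat.Ico_succ_singleton, Finset.sum_singleton] at h2
  push_cast at h2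
  have h3 : I ≤ η / 2 * q := by
    have : (Q : ℝ) ≤ q := by exact_mod_cast hq
    have := hQ.trans this
    rw [div_le_iff₀ (by linarith)] at this
    linarith
  have h4 : Real.log (1 + |f (x - q * α + i * α)|) ≤ η * q := by linarith
  rw [Real.log_le_iff_le_exp (by positivity)] at h4
  linarith

lemma frequently_good (S : ℕ → Prop) (hS : ∃ᶠ k in atTop, S k) (Bad : ℕ → Set ℝ) (u : ℕ → ℝ≥0∞)
    (hu : Tendsto u atTop (nhds 0)) (hB : ∀ k, S k → mu01 (Bad k) ≤ u k) :
    ∀ᵐ x ∂mu01, ∃ᶠ k in atTop, S k ∧ x ∉ Bad k := by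
  have h : ∀ K : ℕ, ∀ᵐ x ∂mu01, ∃ k ≥ K, S k ∧ x ∉ Bad k := by
    intro K
    rw [ae_iff]
    rw [← nonpos_iff_eq_zero]
    apply le_of_forall_pos_le_add
    intro e he
    rw [zero_add]
    have h1 := ENNReal.tendsto_nhds_zero.mp hu e he
    obtain ⟨k, hk1, hk2, hk3⟩ := (hS.and_eventually (h1.and (eventually_ge_atTop K))).exists
    refine le_trans (measure_mono ?_) ((hB k hk1).trans hk2)
    intro x hx
    simp only [Set.mem_ofPred_eq] at hx
    push Not at hx
    exact hx k hk3 hk1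
  filter_upwards [ae_all_iff.mpr h] with x hx
  rw [frequently_atTop]
  exact hx

lemma good_ae (α : ℝ) (hα : Irrational α) (f : ℝ → ℝ)
    (hmeas : Measurable f) (hper : Function.Periodic f 1) (hsv : sVar f ≠ ⊤)
    (hlog : Integrable (fun x => Real.log (1 + |f x|)) mu01)
    (G : ℝ → ℝ) (hm : Measurable G) (hp : Function.Periodic G 1) (hi : Integrable G mu01)
    (ε η b : ℝ) (hε : 0 < ε) (hη : 0 < η)
    (hb : ∃ᶠ k in atTop, b ≤ Real.log (cfDen α (k+1)) / (cfDen α k)) :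
    ∀ᵐ x ∂mu01, ∃ᶠ k in atTop,
      (∀ c d : ℕ, c ≤ d → d ≤ 3 * cfDen α k →
        ∑ i ∈ Finset.Ico c d, G (x - cfDen α k * α + i * α) ≤
        ((d : ℝ) - c) * (∫ x, G x ∂mu01) + ε * cfDen α k) ∧
      (∀ i < 3 * cfDen α k, |f (x - cfDen α k * α + i * α)| ≤ Real.exp (η * cfDen α k)) ∧
      ∑ i ∈ Finset.range (2 * cfDen α k),
        |f (x - cfDen α k * α + ((i + cfDen α k : ℕ) : ℝ) * α) - f (x - cfDen α k * α + i * α)|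
          ≤ Real.exp ((3 * η - b) * cfDen α k) := by
  have hq := cfDen_tendsto α hα
  have t1 := (event1 α hα G hm hp hi ε hε).comp hq
  have t2 := (event2 α hα f hmeas hper hlog η hη).comp hq
  have t3 : Tendsto (fun q : ℕ => 6 * q * sVar f * ENNReal.ofReal (Real.exp (-(2 * η) * q)))
      atTop (nhds 0) := by
    have e1 : Tendsto (fun q : ℕ => (q : ℝ) * Real.exp (-(2 * η) * q)) atTop (nhds 0) := by
      have h := Real.tendsto_pow_mul_exp_neg_atTop_nhds_zero 1
      have h2 : Tendsto (fun q : ℕ => (2 * η) * (q : ℝ)) atTop atTop :=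
        tendsto_natCast_atTop_atTop.const_mul_atTop (by linarith)
      have h3 := (h.comp h2).const_mul (1 / (2 * η))
      rw [mul_zero] at h3
      refine h3.congr ?_
      intro q
      simp only [Function.comp, pow_one]
      rw [neg_mul]
      field_simp
    have e2 := ENNReal.tendsto_ofReal e1
    rw [ENNReal.ofReal_zero] at e2
    have e3 := ENNReal.Tendsto.const_mul (a := 6 * sVar f) e2
      (Or.inr (ENNReal.mul_ne_top (by norm_num) hsv))
    rw [mul_zero] at e3
    refine e3.congr ?_
    intro q
    rw [ENNReal.ofReal_mul (Nat.cast_nonneg _), ENNReal.ofReal_natCast]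
    ring
  have t3' := t3.comp hq
  have hu := (t1.add t2).add t3'
  simp only [add_zero] at hu
  refine (frequently_good _ hb (fun k =>
    ({x | ¬ ∀ c d : ℕ, c ≤ d → d ≤ 3 * cfDen α k →
        ∑ i ∈ Finset.Ico c d, G (x - cfDen α k * α + i * α) ≤
        ((d : ℝ) - c) * (∫ x, G x ∂mu01) + ε * cfDen α k} ∪
      {x | ¬ ∀ i < 3 * cfDen α k, |f (x - cfDen α k * α + i * α)| ≤ Real.exp (η * cfDen α k)}) ∪
      {x | (∀ i < 3 * cfDen α k, |f (x - cfDen α k * α + i * α)| ≤ Real.exp (η * cfDen α k)) ∧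
        Real.exp ((3 * η - b) * cfDen α k) < ∑ i ∈ Finset.range (2 * cfDen α k),
        |f (x - cfDen α k * α + ((i + cfDen α k : ℕ) : ℝ) * α) - f (x - cfDen α k * α + i * α)|})
    _ hu ?_).mono ?_
  · intro k hk
    refine (measure_union_le _ _).trans (add_le_add ((measure_union_le _ _).trans le_rfl) ?_)
    obtain ⟨p, hp⟩ := cf_approx α hα k
    have hqk : (1:ℝ) ≤ cfDen α k := by exact_mod_cast cfDen_pos α hα k
    have hqk1 : (1:ℝ) ≤ cfDen α (k + 1) := by exact_mod_cast cfDen_pos α hα (k + 1)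
    refine (event3 α f hmeas hper (cfDen α k) (cfDen α k * α - p) p (by ring) ?_
      (Real.exp (η * cfDen α k)) _ ?_ (Real.exp_pos _)).trans ?_
    · refine hp.trans ?_
      rw [div_le_one (by linarith)]
      exact hqk1
    · apply Real.one_le_exp; positivity
    · simp only [Function.comp]
      gcongr
      have h1 : 1 / (cfDen α (k + 1) : ℝ) ≤ Real.exp (-(b * cfDen α k)) := by
        rw [Real.exp_neg, one_div]
        apply inv_anti₀ (Real.exp_pos _)
        rw [← Real.le_log_iff_exp_le (by linarith)]
        rwa [le_div_iff₀ (by linarith)] at hk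
      calc _ ≤ Real.exp (η * cfDen α k) * Real.exp (-(b * cfDen α k)) /
            Real.exp ((3 * η - b) * cfDen α k) := by
            gcongr
            exact hp.trans h1
        _ = _ := by
          rw [← Real.exp_add, ← Real.exp_sub]
          congr 1; ring
  · intro x hx
    refine hx.mono ?_
    rintro k ⟨-, hk⟩
    simp only [Set.mem_union, Set.mem_ofPred_eq, not_or, not_not, not_and, not_lt] at hk
    exact ⟨hk.1.1, hk.1.2, hk.2 hk.1.2⟩

/-! the majorants of `log ‖S_n^E‖` -/
def Kf (α : ℝ) (f : ℝ → ℝ) (n : ℕ) (c : ℝ) (x : ℝ) : ℝ :=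
  n * ∏ j ∈ Finset.range n, (c + |f (x + j * α)|)

def Gf (α : ℝ) (f : ℝ → ℝ) (n : ℕ) (E r c : ℝ) (x : ℝ) : ℝ :=
  Real.log (‖schCocycle α f E n x‖ + r * Kf α f n c x)

lemma Kf_nonneg (α : ℝ) (f : ℝ → ℝ) (n : ℕ) (c : ℝ) (hc : 0 ≤ c) (x : ℝ) : 0 ≤ Kf α f n c x := by
  exact mul_nonneg (Nat.cast_nonneg _) (Finset.prod_nonneg fun j _ => by positivity)

lemma sch_diff (α : ℝ) (f : ℝ → ℝ) (n : ℕ) (E E' r c : ℝ) (hr : |E - E'| ≤ r)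
    (h1 : |E| + 1 ≤ c) (h2 : |E'| + 1 ≤ c) (x : ℝ) :
    ‖schCocycle α f E n x‖ ≤ ‖schCocycle α f E' n x‖ + r * Kf α f n c x := by
  have hb : ∀ e u : ℝ, |e| + 1 ≤ c → |e - u| + 1 ≤ c + |u| := by
    intro e u h
    have : |e - u| ≤ |e| + |u| := abs_sub _ _
    linarith
  have h3 := norm_tm_sub_le' (fun i => E' - f (x + i * α)) (fun i => E - f (x + i * α))
    (fun i => c + |f (x + i * α)|) 0 n r (fun i => hb _ _ h2) (fun i => hb _ _ h1)
    (fun i => by simpa using hr)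
  rw [← schCocycle_eq_tm0, ← schCocycle_eq_tm0] at h3
  simp only [zero_add] at h3
  have h4 := norm_sub_norm_le (schCocycle α f E n x) (schCocycle α f E' n x)
  rw [Kf]
  linarith

lemma Gf_nonneg (α : ℝ) (f : ℝ → ℝ) (n : ℕ) (E r c : ℝ) (hr : 0 ≤ r) (hc : 0 ≤ c) (x : ℝ) :
    0 ≤ Gf α f n E r c x := by
  apply Real.log_nonneg
  have := one_le_norm_sch α f E n x
  have := mul_nonneg hr (Kf_nonneg α f n c hc x)
  linarith

lemma log_sch_le_Gf (α : ℝ) (f : ℝ → ℝ) (n : ℕ) (E E' r c : ℝ) (hr : |E - E'| ≤ r)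
    (h1 : |E| + 1 ≤ c) (h2 : |E'| + 1 ≤ c) (x : ℝ) :
    Real.log ‖schCocycle α f E n x‖ ≤ Gf α f n E' r c x := by
  have := one_le_norm_sch α f E n x
  exact Real.log_le_log (by linarith) (sch_diff α f n E E' r c hr h1 h2 x)

lemma Gf_le_Gf (α : ℝ) (f : ℝ → ℝ) (n : ℕ) (E E' r c : ℝ) (hr : |E - E'| ≤ r)
    (h1 : |E| + 1 ≤ c) (h2 : |E'| + 1 ≤ c) (x : ℝ) :
    Gf α f n E' r c x ≤ Gf α f n E (2 * r) c x := by
  have h3 := one_le_norm_sch α f E' n x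
  have h4 := sch_diff α f n E' E r c (by rwa [abs_sub_comm]) h2 h1 x
  have h5 := mul_nonneg ((abs_nonneg _).trans hr)
    (Kf_nonneg α f n c (by linarith [abs_nonneg E]) x)
  apply Real.log_le_log (by linarith)
  linarith

lemma Kf_measurable (α : ℝ) (f : ℝ → ℝ) (hmeas : Measurable f) (n : ℕ) (c : ℝ) :
    Measurable (Kf α f n c) := by
  apply Measurable.const_mul
  apply Finset.measurable_fun_prod
  intro j _
  exact measurable_const.add (hmeas.comp (measurable_add_const _)).norm

lemma sch_norm_measurable (α : ℝ) (f : ℝ → ℝ) (hmeas : Measurable f) (n : ℕ) (E : ℝ) :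
    Measurable (fun x => ‖schCocycle α f E n x‖) := by
  have h : ∀ i j, Measurable (fun x => schCocycle α f E n x i j) := by
    induction n with
    | zero => intro i j; simp [schCocycle]
    | succ n ih =>
      intro i j
      have hs : Measurable (fun x => ((E - f (x + n * α) : ℝ) : ℂ)) :=
        Complex.measurable_ofReal.comp (measurable_const.sub (hmeas.comp (measurable_add_const _)))
      simp only [schCocycle_succ, stepM, Matrix.mul_apply, Fin.sum_univ_two]
      fin_cases i
      · simp only [Fin.zero_eta, Matrix.of_apply, Matrix.cons_val_zero, Matrix.cons_val_one]
        exact (hs.mul (ih 0 j)).add ((ih 1 j).const_mul _)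
      · simp only [Fin.mk_one, Matrix.of_apply, Matrix.cons_val_zero, Matrix.cons_val_one]
        exact ((ih 0 j).const_mul _).add ((ih 1 j).const_mul _)
  simp only [norm_M2]
  exact (((h 0 0).norm.add (h 0 1).norm)).max (((h 1 0).norm.add (h 1 1).norm))

lemma Gf_measurable (α : ℝ) (f : ℝ → ℝ) (hmeas : Measurable f) (n : ℕ) (E r c : ℝ) :
    Measurable (Gf α f n E r c) :=
  Real.measurable_log.comp ((sch_norm_measurable α f hmeas n E).add
    ((Kf_measurable α f hmeas n c).const_mul r))

lemma Gf_periodic (α : ℝ) (f : ℝ → ℝ) (hper : Function.Periodic f 1) (n : ℕ) (E r c : ℝ) :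
    Function.Periodic (Gf α f n E r c) 1 := by
  intro x
  have h : ∀ j : ℕ, f (x + 1 + j * α) = f (x + j * α) := by
    intro j
    rw [show x + 1 + j * α = x + j * α + 1 by ring, hper]
  simp only [Gf, Kf, schCocycle_eq_tm0, h]

/-- dominating function -/
def Df (α : ℝ) (f : ℝ → ℝ) (n : ℕ) (c : ℝ) (x : ℝ) : ℝ :=
  Real.log (1 + 2 * n) + ∑ j ∈ Finset.range n, (Real.log c + Real.log (1 + |f (x + j * α)|))

lemma Gf_le_Df (α : ℝ) (f : ℝ → ℝ) (n : ℕ) (E r c : ℝ) (hr : 0 ≤ r) (hr2 : r ≤ 2)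
    (hc : |E| + 1 ≤ c) (x : ℝ) : Gf α f n E r c x ≤ Df α f n c x := by
  have hc1 : 1 ≤ c := by linarith [abs_nonneg E]
  have hb : ∀ u : ℝ, |E - u| + 1 ≤ c + |u| := by
    intro u
    have : |E - u| ≤ |E| + |u| := abs_sub _ _
    linarith
  have h1 := norm_tm_le (fun i => E - f (x + i * α)) (fun i => c + |f (x + i * α)|) 0 n
    (fun i => hb _)
  rw [← schCocycle_eq_tm0] at h1
  simp only [zero_add] at h1
  have h0 := one_le_norm_sch α f E n x
  set P := ∏ j ∈ Finset.range n, (c + |f (x + j * α)|) with hP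
  have hP0 : 1 ≤ P := h0.trans h1
  have h2 : ‖schCocycle α f E n x‖ + r * Kf α f n c x ≤ (1 + 2 * n) * P := by
    rw [Kf, ← hP]
    have : r * (n * P) ≤ 2 * (n * P) := mul_le_mul_of_nonneg_right hr2 (by positivity)
    linarith
  have hK := mul_nonneg hr (Kf_nonneg α f n c (by linarith) x)
  refine (Real.log_le_log (by linarith) h2).trans ?_
  rw [Real.log_mul (by positivity) (by positivity), Df, hP, Real.log_prod (fun j _ => by positivity)]
  gcongr with j _
  rw [← Real.log_mul (by positivity) (by positivity)]
  apply Real.log_le_log (by positivity)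
  nlinarith [abs_nonneg (f (x + j * α))]

lemma Df_integrable (α : ℝ) (f : ℝ → ℝ) (hmeas : Measurable f) (hper : Function.Periodic f 1)
    (hlog : Integrable (fun x => Real.log (1 + |f x|)) mu01) (n : ℕ) (c : ℝ) :
    Integrable (Df α f n c) mu01 := by
  have hm : Measurable (fun x => Real.log (1 + |f x|)) :=
    Real.measurable_log.comp (measurable_const.add hmeas.norm)
  apply (integrable_const _).add
  apply integrable_finsetSum
  intro j _
  apply (integrable_const _).add
  refine ⟨(hm.comp (measurable_add_const _)).aestronglyMeasurable, ?_⟩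
  have := lintegral_shift (fun x => ‖Real.log (1 + |f x|)‖ₑ) (fun x => by simp only [hper x]) (j * α)
  exact this.trans_lt hlog.2

lemma Gf_integrable (α : ℝ) (f : ℝ → ℝ) (hmeas : Measurable f) (hper : Function.Periodic f 1)
    (hlog : Integrable (fun x => Real.log (1 + |f x|)) mu01) (n : ℕ) (E r c : ℝ)
    (hr : 0 ≤ r) (hr2 : r ≤ 2) (hc : |E| + 1 ≤ c) :
    Integrable (Gf α f n E r c) mu01 := by
  refine (Df_integrable α f hmeas hper hlog n c).mono'
    (Gf_measurable α f hmeas n E r c).aestronglyMeasurable (Eventually.of_forall fun x => ?_)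
  rw [Real.norm_eq_abs, abs_of_nonneg (Gf_nonneg α f n E r c hr (by linarith [abs_nonneg E]) x)]
  exact Gf_le_Df α f n E r c hr hr2 hc x

lemma Gf_limit (α : ℝ) (f : ℝ → ℝ) (hmeas : Measurable f) (hper : Function.Periodic f 1)
    (hlog : Integrable (fun x => Real.log (1 + |f x|)) mu01) (n : ℕ) (E d : ℝ) (hd : 0 < d) :
    ∃ (E' : ℚ) (m c : ℕ), |E - E'| ≤ 1 / ((m : ℝ) + 1) ∧ |E| + 1 ≤ c ∧ |(E' : ℝ)| + 1 ≤ c ∧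
      ∫ x, Gf α f n E' (1 / ((m : ℝ) + 1)) c x ∂mu01 ≤
        (∫ x, Real.log ‖schCocycle α f E n x‖ ∂mu01) + d := by
  obtain ⟨c, hc⟩ := exists_nat_ge (|E| + 2)
  have hr : ∀ m : ℕ, 0 ≤ 2 * (1 / ((m : ℝ) + 1)) ∧ 2 * (1 / ((m : ℝ) + 1)) ≤ 2 := by
    intro m
    have : 1 / ((m : ℝ) + 1) ≤ 1 := by
      rw [div_le_one (by positivity)]
      linarith [(Nat.cast_nonneg m : (0:ℝ) ≤ m)]
    exact ⟨by positivity, by linarith⟩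
  have hlim : Tendsto (fun m : ℕ => ∫ x, Gf α f n E (2 * (1 / ((m : ℝ) + 1))) c x ∂mu01) atTop
      (nhds (∫ x, Real.log ‖schCocycle α f E n x‖ ∂mu01)) := by
    apply tendsto_integral_of_dominated_convergence (Df α f n c)
    · intro m; exact (Gf_measurable α f hmeas n E _ c).aestronglyMeasurable
    · exact Df_integrable α f hmeas hper hlog n c
    · intro m
      refine Eventually.of_forall fun x => ?_
      rw [Real.norm_eq_abs, abs_of_nonneg
        (Gf_nonneg α f n E _ c (hr m).1 (Nat.cast_nonneg _) x)]
      exact Gf_le_Df α f n E _ c (hr m).1 (hr m).2 (by linarith) x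
    · refine Eventually.of_forall fun x => ?_
      have h0 := one_le_norm_sch α f E n x
      apply Tendsto.log _ (by linarith)
      have h1 := ((tendsto_one_div_add_atTop_nhds_zero_nat (𝕜 := ℝ)).const_mul 2).mul_const
        (Kf α f n c x)
      have h2 := h1.const_add ‖schCocycle α f E n x‖
      simpa using h2
  obtain ⟨m, hm⟩ := ((tendsto_order.mp hlim).2 _
    (lt_add_of_pos_right _ hd)).exists
  have hrm : 0 < 1 / ((m : ℝ) + 1) := by positivity
  obtain ⟨E', hE1, hE2⟩ := exists_rat_btwn (lt_add_of_pos_right E hrm)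
  have hEE : |E - E'| ≤ 1 / ((m : ℝ) + 1) := by
    rw [abs_le]; constructor <;> linarith
  have hle1 : 1 / ((m : ℝ) + 1) ≤ 1 := by linarith [(hr m).2]
  have hE'c : |(E' : ℝ)| + 1 ≤ c := by
    have : |(E' : ℝ)| ≤ |E| + |E - E'| := by
      have := abs_sub E (E - E')
      simpa using this
    linarith
  refine ⟨E', m, c, hEE, by linarith, hE'c, ?_⟩
  refine le_trans (integral_mono ?_ ?_ ?_) hm.le
  · exact Gf_integrable α f hmeas hper hlog n E' _ c hrm.le (by linarith) hE'c
  · exact Gf_integrable α f hmeas hper hlog n E _ c (hr m).1 (hr m).2 (by linarith)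
  · intro x
    have hcc := hE'c
    exact Gf_le_Gf α f n E E' _ c hEE (by linarith) hcc x

/-- the pair of consecutive values of a solution -/
def Phi (ψ : ℤ → ℂ) (m : ℤ) : Fin 2 → ℂ := ![ψ m, ψ (m - 1)]

lemma step_Phi (ψ : ℤ → ℂ) (α x E : ℝ) (f : ℝ → ℝ)
    (h : ∀ m : ℤ, ψ (m + 1) + ψ (m - 1) + (f (x + m * α) : ℂ) * ψ m = (E : ℂ) * ψ m) (m : ℤ) :
    (stepM (E - f (x + m * α))).mulVec (Phi ψ m) = Phi ψ (m + 1) := by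
  have := h m
  ext i
  fin_cases i
  · simp [stepM, Phi, Matrix.mulVec, dotProduct, Fin.sum_univ_two]
    linear_combination -this
  · simp [stepM, Phi, Matrix.mulVec, dotProduct, Fin.sum_univ_two]

lemma tm_Phi (ψ : ℤ → ℂ) (α x E : ℝ) (f : ℝ → ℝ)
    (h : ∀ m : ℤ, ψ (m + 1) + ψ (m - 1) + (f (x + m * α) : ℂ) * ψ m = (E : ℂ) * ψ m)
    (q a l : ℕ) :
    (tm (fun i => E - f (x - q * α + i * α)) a l).mulVec (Phi ψ ((a : ℤ) - q)) =
      Phi ψ ((a : ℤ) + l - q) := by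
  induction l with
  | zero => simp [tm]
  | succ l ih =>
    rw [tm, ← Matrix.mulVec_mulVec, ih]
    have h2 := step_Phi ψ α x E f h ((a : ℤ) + l - q)
    rw [show x + (((a : ℤ) + l - q : ℤ) : ℝ) * α = x - q * α + ((a + l : ℕ) : ℝ) * α by
      push_cast; ring] at h2
    rw [h2]
    congr 1
    push_cast
    ring

lemma Phi_zero_ne (ψ : ℤ → ℂ) (α x E : ℝ) (f : ℝ → ℝ)
    (h : ∀ m : ℤ, ψ (m + 1) + ψ (m - 1) + (f (x + m * α) : ℂ) * ψ m = (E : ℂ) * ψ m)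
    (hne : ψ ≠ 0) : Phi ψ 0 ≠ 0 := by
  intro h0
  apply hne
  have a0 : ψ 0 = 0 := by simpa [Phi] using congrFun h0 0
  have a1 : ψ (-1) = 0 := by simpa [Phi] using congrFun h0 1
  have hp : ∀ n : ℕ, ψ n = 0 ∧ ψ ((n : ℤ) - 1) = 0 := by
    intro n
    induction n with
    | zero => simp [a0, a1]
    | succ n ih =>
      have := h n
      rw [ih.1, ih.2] at this
      refine ⟨?_, ?_⟩
      · push_cast
        simpa using this
      · push_cast
        simpa using ih.1
  have hn : ∀ n : ℕ, ψ (-(n : ℤ)) = 0 ∧ ψ (-(n : ℤ) - 1) = 0 := by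
    intro n
    induction n with
    | zero => simp [a0, a1]
    | succ n ih =>
      have := h (-(n : ℤ) - 1)
      rw [show -(n : ℤ) - 1 + 1 = -n by ring, ih.1, ih.2] at this
      rw [show -((n + 1 : ℕ) : ℤ) = -(n : ℤ) - 1 by push_cast; ring]
      refine ⟨ih.2, ?_⟩
      simpa using this
  funext m
  obtain ⟨n, rfl | rfl⟩ := m.eq_nat_or_neg
  · exact (hp n).1
  · exact (hn n).1

lemma Phi_tendsto (ψ : ℤ → ℂ) (hs : Summable (fun m : ℤ => ‖ψ m‖ ^ 2)) :
    Tendsto (Phi ψ) cofinite (nhds 0) := by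
  have h1 : Tendsto ψ cofinite (nhds 0) := by
    have h := hs.tendsto_cofinite_zero
    have h2 := h.sqrt
    simp only [Real.sqrt_sq (norm_nonneg _), Real.sqrt_zero] at h2
    exact tendsto_zero_iff_norm_tendsto_zero.2 h2
  have h2 : Tendsto (fun m : ℤ => ψ (m - 1)) cofinite (nhds 0) :=
    h1.comp (sub_left_injective.tendsto_cofinite)
  rw [tendsto_pi_nhds]
  intro i
  fin_cases i
  · simpa [Phi] using h1
  · simpa [Phi] using h2

lemma no_eig (α : ℝ) (hα : Irrational α) (f : ℝ → ℝ) (x E : ℝ) (n : ℕ) (hn : 1 ≤ n)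
    (G : ℝ → ℝ) (lam ε η b : ℝ) (hlam : 0 ≤ lam) (hε : 0 ≤ ε) (hη : 0 ≤ η)
    (hG : ∀ y, Real.log ‖schCocycle α f E n y‖ ≤ G y)
    (hexp : lam / n + 2 * ε / n + 4 * n * η + 3 * η - b < 0)
    (hgood : ∃ᶠ k in atTop,
      (∀ c d : ℕ, c ≤ d → d ≤ 3 * cfDen α k →
        ∑ i ∈ Finset.Ico c d, G (x - cfDen α k * α + i * α) ≤
        ((d : ℝ) - c) * lam + ε * cfDen α k) ∧
      (∀ i < 3 * cfDen α k, |f (x - cfDen α k * α + i * α)| ≤ Real.exp (η * cfDen α k)) ∧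
      ∑ i ∈ Finset.range (2 * cfDen α k),
        |f (x - cfDen α k * α + ((i + cfDen α k : ℕ) : ℝ) * α) - f (x - cfDen α k * α + i * α)|
          ≤ Real.exp ((3 * η - b) * cfDen α k))
    (ψ : ℤ → ℂ) (hne : ψ ≠ 0) (hs : Summable (fun m : ℤ => ‖ψ m‖ ^ 2))
    (h : ∀ m : ℤ, ψ (m + 1) + ψ (m - 1) + (f (x + m * α) : ℂ) * ψ m = (E : ℂ) * ψ m) :
    False := by
  have hP0 := Phi_zero_ne ψ α x E f h hne
  have hpos : 0 < ‖Phi ψ 0‖ / 4 := by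
    have := norm_pos_iff.2 hP0
    positivity
  have hq := cfDen_tendsto α hα
  have hT := Phi_tendsto ψ hs
  have hev : ∀ᶠ m in cofinite, ‖Phi ψ m‖ ≤ ‖Phi ψ 0‖ / 4 := by
    have := hT.norm
    rw [norm_zero] at this
    exact this.eventually_le_const hpos
  have e1 : ∀ᶠ k in atTop, ‖Phi ψ (-(cfDen α k : ℤ))‖ ≤ ‖Phi ψ 0‖ / 4 := by
    have hi : Function.Injective (fun k : ℕ => -(k : ℤ)) := fun a b hab => by simpa using hab
    have := hi.tendsto_cofinite.eventually hev
    rw [Nat.cofinite_eq_atTop] at this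
    exact hq.eventually this
  have e2 : ∀ᶠ k in atTop, ‖Phi ψ ((cfDen α k : ℤ))‖ ≤ ‖Phi ψ 0‖ / 4 := by
    have hi : Function.Injective (fun k : ℕ => (k : ℤ)) := fun a b hab => by simpa using hab
    have := hi.tendsto_cofinite.eventually hev
    rw [Nat.cofinite_eq_atTop] at this
    exact hq.eventually this
  have e3 : ∀ᶠ k in atTop, ‖Phi ψ (2 * (cfDen α k : ℤ))‖ ≤ ‖Phi ψ 0‖ / 4 := by
    have hi : Function.Injective (fun k : ℕ => 2 * (k : ℤ)) := fun a b hab => by simpa using hab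
    have := hi.tendsto_cofinite.eventually hev
    rw [Nat.cofinite_eq_atTop] at this
    exact hq.eventually this
  set C := Real.log (|E| + 2) with hC
  have hC0 : 0 ≤ C := Real.log_nonneg (by linarith [abs_nonneg E])
  have e4 : ∀ᶠ k in atTop, (cfDen α k : ℝ) * (lam / n + 2 * ε / n + 4 * n * η + 3 * η - b) +
      4 * n * C ≤ Real.log (1 / 4) := by
    have h1 : Tendsto (fun k => (cfDen α k : ℝ) * (lam / n + 2 * ε / n + 4 * n * η + 3 * η - b) +
      4 * n * C) atTop atBot :=
      tendsto_atBot_add_const_right _ _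
        ((tendsto_natCast_atTop_atTop.comp hq).atTop_mul_const_of_neg hexp)
    exact h1.eventually_le_atBot _
  obtain ⟨k, ⟨g1, g2, g3⟩, f1, f2, f3, f4⟩ :=
    (hgood.and_eventually (e1.and (e2.and (e3.and e4)))).exists
  set q := cfDen α k with hqdef
  set v : ℕ → ℝ := fun i => E - f (x - q * α + i * α) with hv
  have key := block_close v n q hn lam ε (η * q + C) (Real.exp ((3 * η - b) * q)) hlam hε
    (by positivity)
    (by
      intro a c hac hc
      refine le_trans (Finset.sum_le_sum fun i _ => ?_) (g1 a c hac hc)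
      rw [hv, ← schCocycle_eq_tm]
      exact hG _)
    (by
      intro i hi
      have h1 := g2 i hi
      have h2 : 1 ≤ Real.exp (η * q) := Real.one_le_exp (by positivity)
      have h3 : |v i| ≤ |E| + |f (x - q * α + i * α)| := abs_sub _ _
      have h4 : |v i| + 1 ≤ Real.exp (η * q) * (|E| + 2) := by nlinarith [abs_nonneg E]
      refine (Real.log_le_log (by positivity) h4).trans ?_
      rw [Real.log_mul (by positivity) (by positivity), Real.log_exp])
    (by
      refine le_trans (le_of_eq (Finset.sum_congr rfl fun i _ => ?_)) g3
      simp only [hv]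
      rw [abs_sub_comm]
      congr 1
      ring)
  have hsm : Real.exp ((q * lam + 2 * (ε * q)) / n + 4 * n * (η * q + C)) *
      Real.exp ((3 * η - b) * q) ≤ 1 / 4 := by
    rw [← Real.exp_add]
    rw [← Real.le_log_iff_exp_le (by norm_num)]
    refine le_trans (le_of_eq ?_) f4
    ring
  have c1 := (key 0 (Nat.zero_le _)).trans hsm
  have c2 := (key q le_rfl).trans hsm
  rw [Nat.zero_add] at c1
  have t0 := tm_Phi ψ α x E f h q 0 q
  have t1 := tm_Phi ψ α x E f h q q q
  have t2 := tm_Phi ψ α x E f h q (q + q) q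
  rw [show ((0 : ℕ) : ℤ) - q = -q by simp, show ((0 : ℕ) : ℤ) + q - q = 0 by simp] at t0
  rw [show (q : ℤ) - q = 0 by simp, show (q : ℤ) + q - q = q by simp] at t1
  rw [show ((q + q : ℕ) : ℤ) - q = q by simp,
    show ((q + q : ℕ) : ℤ) + q - q = 2 * q by push_cast; ring] at t2
  exact hP0 (gordon _ _ _ _ _ _ _ (det_tm _ _ _) (det_tm _ _ _) t0 t1 t2 c1 c2 f1 f2 f3)

lemma good_all (α : ℝ) (hα : Irrational α) (f : ℝ → ℝ)
    (hmeas : Measurable f) (hper : Function.Periodic f 1) (hsv : sVar f ≠ ⊤)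
    (hlog : Integrable (fun x => Real.log (1 + |f x|)) mu01) :
    ∀ᵐ x ∂mu01, ∀ (n : ℕ) (E' : ℚ) (m c : ℕ) (ε η b : ℚ), |(E' : ℝ)| + 1 ≤ c → 0 < ε → 0 < η →
      (∃ᶠ k in atTop, (b : ℝ) ≤ Real.log (cfDen α (k+1)) / (cfDen α k)) →
      ∃ᶠ k in atTop,
      (∀ i d : ℕ, i ≤ d → d ≤ 3 * cfDen α k →
        ∑ i ∈ Finset.Ico i d, Gf α f n E' (1 / ((m : ℝ) + 1)) c (x - cfDen α k * α + i * α) ≤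
        ((d : ℝ) - i) * (∫ x, Gf α f n E' (1 / ((m : ℝ) + 1)) c x ∂mu01) + ε * cfDen α k) ∧
      (∀ i < 3 * cfDen α k, |f (x - cfDen α k * α + i * α)| ≤ Real.exp (η * cfDen α k)) ∧
      ∑ i ∈ Finset.range (2 * cfDen α k),
        |f (x - cfDen α k * α + ((i + cfDen α k : ℕ) : ℝ) * α) - f (x - cfDen α k * α + i * α)|
          ≤ Real.exp ((3 * η - b) * cfDen α k) := by
  simp only [ae_all_iff]
  intro n E' m c ε η b hc hε hη hb
  have hm0 : 0 ≤ 1 / ((m : ℝ) + 1) := by positivity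
  have hm2 : 1 / ((m : ℝ) + 1) ≤ 2 := by
    rw [div_le_iff₀ (by positivity)]
    linarith [(Nat.cast_nonneg m : (0:ℝ) ≤ m)]
  exact good_ae α hα f hmeas hper hsv hlog _ (Gf_measurable α f hmeas n E' _ c)
    (Gf_periodic α f hper n E' _ c) (Gf_integrable α f hmeas hper hlog n E' _ c hm0 hm2 hc)
    ε η b (by exact_mod_cast hε) (by exact_mod_cast hη) hb

/-- (Sharp arithmetic Gordon theorem for potentials of semi-bounded
variation.) Let `α` be irrational and `f : ℝ → ℝ` a `1`-periodic measurable function of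
semi-bounded variation with `∫₀¹ log(1+|f|) < ∞`, and let `L E` be the Lyapunov exponent of
the Schrödinger cocycle. Then for a.e. `x ∈ [0,1)`, no `E` with `0 < L(E) < β(α)` is an
eigenvalue of `H(x)`: there is no nonzero `ℓ²(ℤ)` solution of
`ψ(n+1) + ψ(n−1) + f(x+nα)ψ(n) = Eψ(n)`. -/
theorem sharp_gordon_semiBoundedVariation (α : ℝ) (hα : Irrational α) (f : ℝ → ℝ)
    (hmeas : Measurable f) (hper : Function.Periodic f 1) (hsv : sVar f ≠ ⊤)
    (hlog : IntegrableOn (fun x => Real.log (1 + |f x|)) (Set.Ico 0 1) volume)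
    (L : ℝ → ℝ)
    (hL : ∀ E : ℝ, Tendsto
      (fun n : ℕ => (1 / n : ℝ) * ∫ x in Set.Ico (0:ℝ) 1, Real.log ‖schCocycle α f E n x‖)
      atTop (nhds (L E))) :
    ∀ᵐ x ∂(volume.restrict (Set.Ico (0:ℝ) 1)), ∀ E : ℝ,
      0 < L E → ((L E : ℝ) : EReal) < cfBeta α →
      ¬ ∃ ψ : ℤ → ℂ, ψ ≠ 0 ∧ Summable (fun m : ℤ => ‖ψ m‖ ^ 2) ∧
        ∀ m : ℤ, ψ (m + 1) + ψ (m - 1) + (f (x + m * α) : ℂ) * ψ m = (E : ℂ) * ψ m := by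
  filter_upwards [good_all α hα f hmeas hper hsv hlog] with x hx
  intro E _ hE
  rintro ⟨ψ, hne, hs, h⟩
  obtain ⟨b, hb1, hb2⟩ := EReal.lt_iff_exists_rat_btwn.1 hE
  have hb1' : L E < (b : ℝ) := by exact_mod_cast hb1
  have hfr : ∃ᶠ k in atTop, (b : ℝ) ≤ Real.log (cfDen α (k+1)) / (cfDen α k) := by
    have := Filter.frequently_lt_of_lt_limsup (by isBoundedDefault) hb2
    refine this.mono fun k hk => ?_
    exact le_of_lt (by exact_mod_cast hk)
  set δ := (b : ℝ) - L E with hδ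
  have hδ0 : 0 < δ := sub_pos.2 hb1'
  obtain ⟨n, hn, hn1⟩ := (((hL E).eventually_lt_const
    (show L E < L E + δ / 8 by linarith)).and (eventually_ge_atTop 1)).exists
  have hn0 : (1 : ℝ) ≤ n := by exact_mod_cast hn1
  have hnpos : (0 : ℝ) < n := by linarith
  obtain ⟨E', m, c, i1, i2, i3, i4⟩ := Gf_limit α f hmeas hper hlog n E (δ / 8) (by positivity)
  set lam := ∫ x, Gf α f n E' (1 / ((m : ℝ) + 1)) c x ∂mu01 with hlam
  have hlam0 : 0 ≤ lam := integral_nonneg fun y =>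
    Gf_nonneg α f n E' _ c (by positivity) (by positivity) y
  have hlamn : lam / n < L E + δ / 4 := by
    have h1 : lam / n ≤ (1 / n : ℝ) * (∫ x, Real.log ‖schCocycle α f E n x‖ ∂mu01) + δ / 8 / n := by
      rw [show (1 / n : ℝ) * (∫ x, Real.log ‖schCocycle α f E n x‖ ∂mu01) + δ / 8 / n =
        ((∫ x, Real.log ‖schCocycle α f E n x‖ ∂mu01) + δ / 8) / n by ring]
      exact div_le_div_of_nonneg_right i4 hnpos.le
    have h2 : δ / 8 / n ≤ δ / 8 := div_le_self (by positivity) hn0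
    linarith
  obtain ⟨ε, hε0, hε1⟩ := exists_rat_btwn (show (0 : ℝ) < δ / 16 by positivity)
  obtain ⟨η, hη0, hη1⟩ := exists_rat_btwn (show (0 : ℝ) < δ / 4 / (4 * n + 3) by positivity)
  have hη2 : (η : ℝ) * (4 * n + 3) < δ / 4 := (lt_div_iff₀ (by positivity)).1 hη1
  have hε2 : 2 * (ε : ℝ) / n ≤ 2 * ε := div_le_self (by positivity) hn0
  exact no_eig α hα f x E n hn1 _ lam ε η b hlam0 hε0.le hη0.le
    (log_sch_le_Gf α f n E E' (1 / ((m : ℝ) + 1)) c i1 i2 i3)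
    (by nlinarith)
    (hx n E' m c ε η b i3 (by exact_mod_cast hε0) (by exact_mod_cast hη0) hfr) ψ hne hs h
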